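/- arXiv:1605.07997 — 4 statements merged into one kernel-verified Lean document; each statement's English description precedes it below -/
import Mathlib

section
/- Let K be a compact convex set in the plane with nonempty interior, and let ab be a diameter of K (a segment of maximal length with endpoints in K). Suppose the perpendicular bisector of ab intersects the boundary of K at two points c and d. Then the perimeter of K is strictly less than 2|ab| + 2|cd|. -/
open Metric MeasureTheory

/-- Supporting functional, represented by a vector. -/
lemma support_vec {K : Set ℂ} (hK : Convex ℝ K)
    (hint : (interior K).Nonempty) {c : ℂ} (hc : c ∈ frontier K) :
    ∃ n : ℂ, n ≠ 0 ∧ ∀ x ∈ K, inner ℝ n (x - c) ≤ 0 := by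
  obtain ⟨f, hf⟩ := geometric_hahn_banach_open_point hK.interior isOpen_interior hc.2
  refine ⟨(InnerProductSpace.toDual ℝ ℂ).symm f, ?_, ?_⟩
  · intro h0
    have : f = 0 := by simpa using h0
    obtain ⟨y, hy⟩ := hint
    have := hf y hy
    simp_all
  · intro x hx
    rw [InnerProductSpace.toDual_symm_apply, map_sub, sub_nonpos]
    have hx' : x ∈ closure (interior K) := by
      rw [hK.closure_interior_eq_closure_of_nonempty_interior hint]; exact subset_closure hx
    have hcl : IsClosed {y : ℂ | f y ≤ f c} := isClosed_le f.continuous continuous_const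
    exact closure_minimal (fun y hy => (hf y hy).le) hcl hx'

/-- Monotonicity of the perimeter. -/
lemma perimeter_mono {K L : Set ℂ} (hKc : IsCompact K) (hK : Convex ℝ K)
    (hint : (interior K).Nonempty) (hKL : K ⊆ L) (hL : Bornology.IsBounded L) :
    μH[1] (frontier K) ≤ μH[1] (frontier L) := by
  have hne : K.Nonempty := hint.mono interior_subset
  have hex : ∀ u : ℂ, ∃ v ∈ K, ∀ w ∈ K, inner ℝ (u - v) (w - v) ≤ 0 := by
    intro u
    obtain ⟨v, hv, h⟩ := exists_norm_eq_iInf_of_complete_convex hne hKc.isComplete hK u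
    exact ⟨v, hv, (norm_eq_iInf_iff_real_inner_le_zero hK hv).1 h⟩
  choose π hπK hπ using hex
  have hlip : LipschitzWith 1 π := by
    refine LipschitzWith.of_dist_le_mul fun u v => ?_
    rw [NNReal.coe_one, one_mul, dist_eq_norm, dist_eq_norm]
    have h1 := hπ u (π v) (hπK v)
    have h2 := hπ v (π u) (hπK u)
    have h3 : inner ℝ (u - v) (π u - π v) ≤ ‖u - v‖ * ‖π u - π v‖ := real_inner_le_norm _ _
    have h4 : ‖π u - π v‖ ^ 2 ≤ inner ℝ (u - v) (π u - π v) := by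
      rw [← real_inner_self_eq_norm_sq]
      have e : inner ℝ (u - v) (π u - π v) - inner ℝ (π u - π v) (π u - π v)
          = - inner ℝ (u - π u) (π v - π u) - inner ℝ (v - π v) (π u - π v) := by
        simp only [inner_sub_left, inner_sub_right]; ring
      linarith
    by_contra! hlt
    have h5 : 0 < ‖π u - π v‖ := lt_of_le_of_lt (norm_nonneg _) hlt
    nlinarith
  have hsub : frontier K ⊆ π '' frontier L := by
    intro x hx
    have hxK : x ∈ K := hKc.isClosed.frontier_subset hx
    obtain ⟨n, hn0, hn⟩ := support_vec hK hint hx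
    have hray : ∃ t : ℝ, 0 ≤ t ∧ x + t • n ∈ frontier L := by
      have hpre : IsPreconnected ((fun t : ℝ => x + t • n) '' Set.Ici 0) :=
        (isPreconnected_Ici).image _ (by fun_prop)
      have hout : ∃ t : ℝ, 0 ≤ t ∧ x + t • n ∉ L := by
        obtain ⟨R, hR⟩ := hL.exists_norm_le
        by_contra! hcon
        have hnp : 0 < ‖n‖ := norm_pos_iff.2 hn0
        have hR0 : 0 ≤ R := (norm_nonneg _).trans (hR x (hKL hxK))
        have h1 := hR _ (hcon ((2 * R + 1) / ‖n‖) (by positivity))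
        have h2 := hR _ (hKL hxK)
        have h3 : ‖((2 * R + 1) / ‖n‖) • n‖ = 2 * R + 1 := by
          rw [norm_smul, Real.norm_of_nonneg (by positivity)]; field_simp
        have h4 : ‖((2 * R + 1) / ‖n‖) • n‖ ≤ ‖x + ((2 * R + 1) / ‖n‖) • n‖ + ‖x‖ := by
          have := norm_sub_le (x + ((2 * R + 1) / ‖n‖) • n) x
          simpa using this
        linarith
      obtain ⟨t, ht, htL⟩ := hout
      by_contra! hcon
      have hd : frontier L ∩ ((fun t : ℝ => x + t • n) '' Set.Ici 0) = ∅ := by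
        rw [Set.eq_empty_iff_forall_notMem]
        rintro _ ⟨h1, s, hs, rfl⟩
        exact hcon s hs h1
      have := isPreconnected_iff_subset_of_disjoint.1 hpre (interior L) (interior Lᶜ)
        isOpen_interior isOpen_interior ?_ ?_
      · rcases this with h | h
        · exact htL (interior_subset (h ⟨t, ht, rfl⟩))
        · exact interior_subset (h ⟨0, Set.mem_Ici.2 le_rfl, rfl⟩) (by simpa using hKL hxK)
      · intro y hy
        by_contra hyn
        have : y ∈ frontier L ∩ ((fun t : ℝ => x + t • n) '' Set.Ici 0) := by
          refine ⟨?_, hy⟩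
          rw [Set.mem_union, not_or, interior_compl, Set.mem_compl_iff, not_not] at hyn
          exact ⟨hyn.2, hyn.1⟩
        rw [hd] at this; exact this
      · rw [Set.eq_empty_iff_forall_notMem]
        rintro y ⟨-, h1, h2⟩
        exact interior_subset h2 (interior_subset h1)
    obtain ⟨t, ht, htL⟩ := hray
    refine ⟨x + t • n, htL, ?_⟩
    have h1 := hπ (x + t • n) x hxK
    have h2 := hn (π (x + t • n)) (hπK _)
    set p := π (x + t • n)
    have h3 : inner ℝ (x + t • n - p) (x - p) = inner ℝ (x - p) (x - p) - t * inner ℝ n (p - x) := by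
      have : x + t • n - p = (x - p) + t • n := by abel
      rw [this, inner_add_left, inner_smul_left, ← neg_sub p x]
      simp only [inner_neg_right, inner_neg_left]; simp; ring
    have h4 : inner ℝ (x - p) (x - p) ≤ 0 := by nlinarith
    rw [real_inner_self_eq_norm_sq] at h4
    have h5 : ‖x - p‖ = 0 := by nlinarith [norm_nonneg (x - p)]
    exact (sub_eq_zero.1 (norm_eq_zero.1 h5)).symm
  calc μH[1] (frontier K) ≤ μH[1] (π '' frontier L) := measure_mono hsub
    _ ≤ _ := by simpa using hlip.hausdorffMeasure_image_le (d := 1) zero_le_one (frontier L)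

/-- The purely algebraic inequality. -/
lemma alg_ineq {p q h : ℝ} (hp : 0 ≤ p) (hq : 0 ≤ q) (hp3 : 3 * p ^ 2 ≤ 1) (hq3 : 3 * q ^ 2 ≤ 1)
    (hden : 0 < 1 - p ^ 2 - q ^ 2 - 3 * (p * q) ^ 2)
    (hh : h * (1 - p ^ 2 - q ^ 2 - 3 * (p * q) ^ 2) = (p + q) * (1 - 3 * (p * q))) :
    p + q - 3 * (p * q) / 2 ≤ h := by
  refine le_of_mul_le_mul_right ?_ hden
  rw [hh]
  have ht : 0 ≤ p * q := by positivity
  have ht3 : 3 * (p * q) ≤ 1 := by nlinarith [sq_nonneg (p - q)]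
  have hs : p + q ≤ 6 / 5 := by nlinarith [sq_nonneg (p - q)]
  have hst : 3 / 2 * (p * q) ≤ p + q := by nlinarith
  generalize hT : p * q = t at *
  have hsq : (p - q) ^ 2 = (p + q) ^ 2 - 4 * t := by rw [← hT]; ring
  have hpq : p ^ 2 + q ^ 2 = (p + q) ^ 2 - 2 * t := by rw [← hT]; ring
  have hy : 0 ≤ (p + q) ^ 2 - 4 * t := by rw [← hsq]; positivity
  generalize p + q = σ at *
  have e1 : 0 ≤ t * (1 - 3 * t) * (3 / 2 * (1 + t) - σ) :=
    mul_nonneg (mul_nonneg ht (by linarith)) (by linarith)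
  have e2 : 0 ≤ (σ ^ 2 - 4 * t) * (σ - 3 / 2 * t) := mul_nonneg hy (by linarith)
  have : 1 - p ^ 2 - q ^ 2 - 3 * t ^ 2 = 1 - (σ ^ 2 - 2 * t) - 3 * t ^ 2 := by linarith
  rw [this]
  nlinarith

/-- Bound on the top edge. -/
lemma edge_ineq {p q : ℝ} (hp : 0 ≤ p) (hq : 0 ≤ q) (hp3 : 3 * p ^ 2 ≤ 1) (hq3 : 3 * q ^ 2 ≤ 1) :
    1 - 8 * (p * q) * (1 - p * q) / ((1 + p ^ 2) * (1 + q ^ 2)) ≤ (1 - 3 * (p * q)) ^ 2 := by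
  have ht : 0 ≤ p * q := by positivity
  have ht3 : 3 * (p * q) ≤ 1 := by nlinarith [sq_nonneg (p - q)]
  have hM : (1 + p ^ 2) * (1 + q ^ 2) ≤ 4 / 3 * (1 + 3 * (p * q) ^ 2) := by
    nlinarith [mul_nonneg (sub_nonneg.2 hp3) (sub_nonneg.2 hq3)]
  have hM0 : 0 < (1 + p ^ 2) * (1 + q ^ 2) := by positivity
  generalize (1 + p ^ 2) * (1 + q ^ 2) = M at *
  generalize p * q = t at *
  have : 6 * t - 9 * t ^ 2 ≤ 8 * t * (1 - t) / M := by
    rw [le_div_iff₀ hM0]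
    have h6 : 0 ≤ 6 * t - 9 * t ^ 2 := by nlinarith
    have := mul_le_mul_of_nonneg_left hM h6
    nlinarith [mul_nonneg (mul_nonneg ht ht) (sq_nonneg (1 - 3 * t))]
  nlinarith

lemma arc_exists {h s : ℝ} (h34 : h ^ 2 ≤ 3 / 4) (hs : 0 ≤ h + s / 2) :
    ∃ α : ℝ, 0 ≤ α ∧ α ≤ Real.pi / 3 ∧ Real.sin α = h + s * (Real.cos α - 1 / 2) ∧
      ∀ θ : ℝ, 0 ≤ θ → θ ≤ Real.pi / 3 → Real.sin θ ≤ h + s * (Real.cos θ - 1 / 2) → θ ≤ α := by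
  have hpi := Real.pi_pos
  have hcomp : IsCompact (Set.Icc 0 (Real.pi / 3) ∩
      {θ : ℝ | Real.sin θ ≤ h + s * (Real.cos θ - 1 / 2)}) :=
    isCompact_Icc.inter_right (isClosed_le (by fun_prop) (by fun_prop))
  obtain ⟨α, ⟨⟨hα0, hα1⟩, hα2⟩, hmax⟩ := hcomp.exists_isGreatest
    ⟨0, ⟨le_rfl, by positivity⟩, by simp only [Set.mem_ofPred_eq, Real.sin_zero, Real.cos_zero]; linarith⟩
  have hcont : ContinuousOn (fun θ : ℝ => Real.sin θ - (h + s * (Real.cos θ - 1 / 2)))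
      (Set.Icc α (Real.pi / 3)) := by fun_prop
  have hα2' : Real.sin α ≤ h + s * (Real.cos α - 1 / 2) := hα2
  have htop : 0 ≤ Real.sin (Real.pi / 3) - (h + s * (Real.cos (Real.pi / 3) - 1 / 2)) := by
    rw [Real.sin_pi_div_three, Real.cos_pi_div_three]
    have h3 : Real.sqrt 3 ^ 2 = 3 := Real.sq_sqrt (by norm_num)
    have h3' : 0 ≤ Real.sqrt 3 := Real.sqrt_nonneg 3
    nlinarith
  obtain ⟨θ, ⟨hθ1, hθ2⟩, hθ3⟩ := intermediate_value_Icc hα1 hcont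
    (show (0 : ℝ) ∈ Set.Icc _ _ from ⟨by linarith, htop⟩)
  simp only at hθ3
  have hle : θ ≤ α := hmax ⟨⟨hα0.trans hθ1, hθ2⟩, by simp only [Set.mem_ofPred_eq]; linarith⟩
  have heq : θ = α := le_antisymm hle hθ1
  subst heq
  exact ⟨θ, hα0, hα1, by linarith, fun t h1 h2 h3 => hmax ⟨⟨h1, h2⟩, h3⟩⟩

lemma half_tan {α : ℝ} (h0 : 0 ≤ α) (h1 : α ≤ Real.pi / 3) :
    ∃ p : ℝ, 0 ≤ p ∧ 3 * p ^ 2 ≤ 1 ∧ α ≤ 2 * p ∧ (0 < α → α < 2 * p) ∧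
      Real.cos α = (1 - p ^ 2) / (1 + p ^ 2) ∧ Real.sin α = 2 * p / (1 + p ^ 2) := by
  have hpi := Real.pi_pos
  have hc : 0 < Real.cos (α / 2) := Real.cos_pos_of_mem_Ioo ⟨by linarith, by linarith⟩
  have ht : Real.tan (α / 2) = Real.sin (α / 2) / Real.cos (α / 2) := Real.tan_eq_sin_div_cos _
  have hsc := Real.sin_sq_add_cos_sq (α / 2)
  have e1 : Real.cos α = (1 - Real.tan (α / 2) ^ 2) / (1 + Real.tan (α / 2) ^ 2) := by
    have : Real.cos α = 2 * Real.cos (α / 2) ^ 2 - 1 := by rw [← Real.cos_two_mul]; ring_nf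
    have h2 : 1 + Real.tan (α / 2) ^ 2 = 1 / Real.cos (α / 2) ^ 2 := by
      rw [ht]; field_simp; linarith
    have h3 : Real.tan (α / 2) ^ 2 = 1 / Real.cos (α / 2) ^ 2 - 1 := by linarith
    rw [this, h2, h3]; field_simp; ring
  have e2 : Real.sin α = 2 * Real.tan (α / 2) / (1 + Real.tan (α / 2) ^ 2) := by
    have : Real.sin α = 2 * Real.sin (α / 2) * Real.cos (α / 2) := by
      rw [← Real.sin_two_mul]; ring_nf
    have h2 : 1 + Real.tan (α / 2) ^ 2 = 1 / Real.cos (α / 2) ^ 2 := by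
      rw [ht]; field_simp; linarith
    rw [this, h2, ht]; field_simp
  have hchalf : 1 / 2 ≤ Real.cos α := by
    rw [← Real.cos_pi_div_three]
    exact Real.cos_le_cos_of_nonneg_of_le_pi h0 (by linarith) h1
  refine ⟨Real.tan (α / 2), Real.tan_nonneg_of_nonneg_of_le_pi_div_two (by linarith) (by linarith),
    ?_, ?_, ?_, e1, e2⟩
  · rw [e1, div_le_div_iff₀ (by norm_num) (by positivity)] at hchalf
    linarith
  · have := Real.le_tan (x := α / 2) (by linarith) (by linarith)
    linarith
  · intro h
    have := Real.lt_tan (x := α / 2) (by linarith) (by linarith)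
    linarith

lemma chord_exit {h s u y : ℝ} (hlt : h ^ 2 < 3 / 4) (hu : 1 / 2 ≤ u)
    (hQ1 : u ^ 2 + (h + s * (u - 1 / 2)) ^ 2 = 1)
    (h1 : y ^ 2 + (h + s * (y - 1 / 2)) ^ 2 ≤ 1) : y ≤ u := by
  by_contra! huy
  have k1 : (y - 1 / 2) * (u ^ 2 + (h + s * (u - 1 / 2)) ^ 2) =
      (y - u) * ((1 / 2) ^ 2 + h ^ 2) + (u - 1 / 2) * (y ^ 2 + (h + s * (y - 1 / 2)) ^ 2)
      - (1 + s ^ 2) * ((y - 1 / 2) * (u - 1 / 2) * (y - u)) := by ring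
  have k2 : 0 ≤ (1 + s ^ 2) * ((y - 1 / 2) * (u - 1 / 2) * (y - u)) :=
    mul_nonneg (by positivity)
      (mul_nonneg (mul_nonneg (by linarith) (by linarith)) (by linarith))
  have k3 := mul_le_mul_of_nonneg_left h1 (sub_nonneg.2 hu)
  have k4 : (y - u) * ((1 / 2) ^ 2 + h ^ 2) < (y - u) * 1 :=
    mul_lt_mul_of_pos_left (by linarith) (by linarith)
  rw [hQ1] at k1
  linarith

/-- The upper half of the circumscribed region. -/
lemma half_region {h s : ℝ} (h34 : h ^ 2 ≤ 3 / 4) (hs1 : 0 ≤ h + s / 2)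
    (hs2 : 0 ≤ h - s / 2) (hT : h ^ 2 = 3 / 4 → s = 0) :
    ∃ α β x₀ x₁ : ℝ, 0 ≤ α ∧ 0 ≤ β ∧ x₀ ≤ x₁ ∧
      (∀ θ : ℝ, 0 ≤ θ → θ ≤ Real.pi / 3 → Real.sin θ ≤ h + s * (Real.cos θ - 1 / 2) → θ ≤ α) ∧
      (∀ θ : ℝ, 0 ≤ θ → θ ≤ Real.pi / 3 → Real.sin θ ≤ h + s * (1 - Real.cos θ - 1 / 2) → θ ≤ β) ∧
      (∀ x : ℝ, x ^ 2 + (h + s * (x - 1 / 2)) ^ 2 ≤ 1 →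
        (x - 1) ^ 2 + (h + s * (x - 1 / 2)) ^ 2 ≤ 1 → x₀ ≤ x ∧ x ≤ x₁) ∧
      α + β + Real.sqrt (1 + s ^ 2) * (x₁ - x₀) ≤ 1 + 2 * h ∧
      (0 < h → α + β + Real.sqrt (1 + s ^ 2) * (x₁ - x₀) < 1 + 2 * h) := by
  have h0 : 0 ≤ h := by linarith
  rcases eq_or_lt_of_le h34 with heq | hlt
  · have hs := hT heq
    subst hs
    have hh : 17 / 20 ≤ h := by nlinarith
    have hpi := Real.pi_lt_d2
    have hpi0 := Real.pi_pos
    refine ⟨Real.pi / 3, Real.pi / 3, 1 / 2, 1 / 2, by positivity, by positivity, le_rfl,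
      fun θ _ h _ => h, fun θ _ h _ => h, ?_, ?_, ?_⟩
    · intro x h1 h2
      constructor <;> nlinarith [sq_nonneg (x - 1 / 2)]
    · simp; linarith
    · intro _; simp; linarith
  · obtain ⟨α, hα0, hα1, hαe, hαm⟩ := arc_exists h34 hs1
    obtain ⟨β, hβ0, hβ1, hβe, hβm⟩ := arc_exists (s := -s) h34 (by linarith)
    obtain ⟨p, hp0, hp3, hαp, hαp', hcα, hsα⟩ := half_tan hα0 hα1
    obtain ⟨q, hq0, hq3, hβq, hβq', hcβ, hsβ⟩ := half_tan hβ0 hβ1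
    have hpi := Real.pi_pos
    have hchα : 1 / 2 ≤ Real.cos α := by
      rw [← Real.cos_pi_div_three]
      exact Real.cos_le_cos_of_nonneg_of_le_pi hα0 (by linarith) hα1
    have hchβ : 1 / 2 ≤ Real.cos β := by
      rw [← Real.cos_pi_div_three]
      exact Real.cos_le_cos_of_nonneg_of_le_pi hβ0 (by linarith) hβ1
    have hqa := Real.sin_sq_add_cos_sq α
    have hqb := Real.sin_sq_add_cos_sq β
    have hlenpos : 0 < Real.cos α + Real.cos β - 1 := by
      by_contra! hcon
      have e1 : Real.cos α = 1 / 2 := by linarith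
      rw [e1] at hαe hqa
      nlinarith
    have hsinrel : Real.sin α - Real.sin β = s * (Real.cos α + Real.cos β - 1) := by
      rw [hαe, hβe]; ring
    have hhrel : h * (Real.cos α + Real.cos β - 1) =
        Real.sin β * (Real.cos α - 1 / 2) + Real.sin α * (Real.cos β - 1 / 2) := by
      rw [hαe, hβe]; ring
    have hP : 0 < 1 + p ^ 2 := by positivity
    have hQ : 0 < 1 + q ^ 2 := by positivity
    -- the length of the edge
    have hlen : Real.sqrt (1 + s ^ 2) * (Real.cos α - (1 - Real.cos β)) ≤ 1 - 3 * (p * q) := by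
      have ht3 : 3 * (p * q) ≤ 1 := by nlinarith [sq_nonneg (p - q)]
      apply le_of_sq_le_sq _ (by linarith)
      rw [mul_pow, Real.sq_sqrt (by positivity)]
      refine le_trans (le_of_eq ?_) (edge_ineq hp0 hq0 hp3 hq3)
      have : (1 + s ^ 2) * (Real.cos α - (1 - Real.cos β)) ^ 2 =
          (Real.cos α + Real.cos β - 1) ^ 2 + (Real.sin α - Real.sin β) ^ 2 := by
        rw [hsinrel]; ring
      rw [this, hcα, hcβ, hsα, hsβ]
      field_simp
      ring
    have hdeneq : Real.cos α + Real.cos β - 1 =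
        (1 - p ^ 2 - q ^ 2 - 3 * (p * q) ^ 2) / ((1 + p ^ 2) * (1 + q ^ 2)) := by
      rw [hcα, hcβ]; field_simp; ring
    have hden : 0 < 1 - p ^ 2 - q ^ 2 - 3 * (p * q) ^ 2 := by
      rw [hdeneq] at hlenpos
      exact (div_pos_iff_of_pos_right (by positivity)).1 hlenpos
    have hh : h * (1 - p ^ 2 - q ^ 2 - 3 * (p * q) ^ 2) = (p + q) * (1 - 3 * (p * q)) := by
      rw [hdeneq, hcα, hcβ, hsα, hsβ] at hhrel
      field_simp at hhrel
      linarith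
    have hfin := alg_ineq hp0 hq0 hp3 hq3 hden hh
    refine ⟨α, β, 1 - Real.cos β, Real.cos α, hα0, hβ0, by linarith, hαm, ?_, ?_, ?_, ?_⟩
    · intro θ h1 h2 h3
      exact hβm θ h1 h2 (by linarith)
    · intro x h1 h2
      constructor
      · have := chord_exit (s := -s) (y := 1 - x) hlt hchβ (by rw [← hβe]; linarith)
          (le_trans (le_of_eq (by ring)) h2)
        linarith
      · exact chord_exit hlt hchα (by rw [← hαe]; linarith) h1
    · linarith
    · intro hpos
      rcases eq_or_lt_of_le hα0 with ha | ha
      · rcases eq_or_lt_of_le hβ0 with hb | hb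
        · exfalso
          rw [← ha, ← hb] at hhrel
          simp at hhrel
          linarith
        · have := hβq' hb
          linarith
      · have := hαp' ha
        linarith

lemma hausdorff_curve_le {f : ℝ → ℂ} {C : ℝ} (hC : 0 ≤ C)
    (hf : ∀ x y, dist (f x) (f y) ≤ C * dist x y) {u v : ℝ} (huv : u ≤ v) :
    μH[1] (f '' Set.Icc u v) ≤ ENNReal.ofReal (C * (v - u)) := by
  have hl : LipschitzWith C.toNNReal f :=
    LipschitzWith.of_dist_le_mul (by rw [Real.coe_toNNReal C hC]; exact hf)
  refine (hl.hausdorffMeasure_image_le (d := 1) zero_le_one _).trans ?_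
  rw [hausdorffMeasure_real, Real.volume_Icc, ENNReal.rpow_one, ENNReal.ofReal_mul hC]
  rfl

lemma dist_le_of_sq {z w : ℂ} {r : ℝ} (hr : 0 ≤ r)
    (h : (z.re - w.re) ^ 2 + (z.im - w.im) ^ 2 ≤ r ^ 2) : dist z w ≤ r := by
  rw [Complex.dist_eq_re_im]
  exact (Real.sqrt_le_left hr).2 h

lemma line_dist (h s x y : ℝ) :
    dist (⟨x, h + s * (x - 1 / 2)⟩ : ℂ) ⟨y, h + s * (y - 1 / 2)⟩
      ≤ Real.sqrt (1 + s ^ 2) * dist x y := by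
  refine dist_le_of_sq (by positivity) (le_of_eq ?_)
  rw [mul_pow, Real.sq_sqrt (by positivity), Real.dist_eq, sq_abs]
  ring

lemma arc_dist (x y : ℝ) :
    (Real.cos x - Real.cos y) ^ 2 + (Real.sin x - Real.sin y) ^ 2 ≤ (dist x y) ^ 2 := by
  have h1 := Real.one_sub_sq_div_two_le_cos (x := x - y)
  rw [Real.cos_sub] at h1
  rw [Real.dist_eq, sq_abs]
  nlinarith [Real.sin_sq_add_cos_sq x, Real.sin_sq_add_cos_sq y]

/-- Angle of a point of the unit circle lying in the lens. -/
lemma exists_angle {x y : ℝ} (h1 : x ^ 2 + y ^ 2 = 1) (h2 : (x - 1) ^ 2 + y ^ 2 ≤ 1) :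
    ∃ θ : ℝ, |θ| ≤ Real.pi / 3 ∧ x = Real.cos θ ∧ y = Real.sin θ := by
  have hx : 1 / 2 ≤ x := by nlinarith
  have hx1 : x ≤ 1 := by nlinarith
  have hpi := Real.pi_pos
  have hy : -1 ≤ y ∧ y ≤ 1 := ⟨by nlinarith, by nlinarith⟩
  have hc : Real.cos (Real.arcsin y) = x := by
    rw [Real.cos_arcsin, show 1 - y ^ 2 = x ^ 2 by linarith]
    exact Real.sqrt_sq (by linarith)
  refine ⟨Real.arcsin y, ?_, hc.symm, (Real.sin_arcsin hy.1 hy.2).symm⟩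
  by_contra! hcon
  have := Real.cos_lt_cos_of_nonneg_of_le_pi (x := Real.pi / 3) (y := |Real.arcsin y|)
    (by positivity) ?_ hcon
  · rw [Real.cos_abs, hc, Real.cos_pi_div_three] at this
    linarith
  · have := abs_le.2 ⟨Real.neg_pi_div_two_le_arcsin y, Real.arcsin_le_pi_div_two y⟩
    linarith

/-- Supporting line at `c`, as a graph, in upward normalised position. -/
lemma support_line {K : Set ℂ} (hK : Convex ℝ K) (hint : (interior K).Nonempty)
    (h0 : (0 : ℂ) ∈ K) (h1 : (1 : ℂ) ∈ K)
    (hd0 : ∀ z ∈ K, z.re ^ 2 + z.im ^ 2 ≤ 1) (hd1 : ∀ z ∈ K, (z.re - 1) ^ 2 + z.im ^ 2 ≤ 1)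
    {c d : ℂ} (hc : c ∈ frontier K) (hdK : d ∈ K) (hcr : c.re = 1 / 2)
    (hdr : d.re = 1 / 2) (hlt : d.im < c.im) :
    0 ≤ c.im ∧ ∃ s : ℝ, 0 ≤ c.im + s / 2 ∧ 0 ≤ c.im - s / 2 ∧ (c.im ^ 2 = 3 / 4 → s = 0) ∧
      ∀ z ∈ K, z.im ≤ c.im + s * (z.re - 1 / 2) := by
  obtain ⟨n, hn0, hn⟩ := support_vec hK hint hc
  have hn' : ∀ z ∈ K, n.re * (z.re - 1 / 2) + n.im * (z.im - c.im) ≤ 0 := by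
    intro z hz
    have := hn z hz
    simp only [Complex.inner, Complex.mul_re, Complex.sub_re, Complex.sub_im, Complex.conj_re,
      Complex.conj_im, hcr] at this
    linarith
  have e0 := hn' 0 h0
  have e1 := hn' 1 h1
  have ed := hn' d hdK
  simp only [Complex.zero_re, Complex.zero_im, Complex.one_re, Complex.one_im, hdr] at e0 e1 ed
  have hnim : 0 < n.im := by
    have : 0 ≤ n.im := by
      by_contra! hneg
      nlinarith
    rcases eq_or_lt_of_le this with h | h
    · exfalso
      apply hn0
      rw [← h] at e0 e1
      apply Complex.ext
      · simp only [Complex.zero_re]; linarith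
      · simp [← h]
    · exact h
  have hc0 : 0 ≤ c.im := by
    by_contra! hneg
    nlinarith
  refine ⟨hc0, ?_⟩
  by_cases hT : c.im ^ 2 = 3 / 4
  · refine ⟨0, by linarith, by linarith, fun _ => rfl, fun z hz => ?_⟩
    have k1 := hd0 z hz
    have k2 := hd1 z hz
    have : z.im ^ 2 ≤ c.im ^ 2 := by nlinarith [sq_nonneg (z.re - 1 / 2)]
    have := abs_le_of_sq_le_sq' this hc0
    linarith [this.2]
  · refine ⟨-n.re / n.im, ?_, ?_, fun h => absurd h hT, fun z hz => ?_⟩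
    · have : c.im + -n.re / n.im / 2 = (n.im * c.im - n.re / 2) / n.im := by field_simp; ring
      rw [this]; apply div_nonneg _ hnim.le; linarith
    · have : c.im - -n.re / n.im / 2 = (n.im * c.im + n.re / 2) / n.im := by field_simp; ring
      rw [this]; apply div_nonneg _ hnim.le; linarith
    · have := hn' z hz
      have h2 : c.im + -n.re / n.im * (z.re - 1 / 2) - z.im =
          -(n.re * (z.re - 1 / 2) + n.im * (z.im - c.im)) / n.im := by field_simp; ring
      have h3 : 0 ≤ c.im + -n.re / n.im * (z.re - 1 / 2) - z.im := by
        rw [h2]; apply div_nonneg _ hnim.le; linarith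
      linarith

/-- Normalised version in the complex plane. -/
theorem normalized {K : Set ℂ} (hKc : IsCompact K) (hK : Convex ℝ K)
    (hint : (interior K).Nonempty) (h0 : (0 : ℂ) ∈ K) (h1 : (1 : ℂ) ∈ K)
    (hdiam : ∀ z ∈ K, ∀ w ∈ K, dist z w ≤ 1) {c d : ℂ} (hc : c ∈ frontier K)
    (hd : d ∈ frontier K) (hcr : c.re = 1 / 2) (hdr : d.re = 1 / 2) (hlt : d.im < c.im) :
    μH[1] (frontier K) < ENNReal.ofReal (2 + 2 * (c.im - d.im)) := by
  have hcK : c ∈ K := hKc.isClosed.frontier_subset hc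
  have hdK : d ∈ K := hKc.isClosed.frontier_subset hd
  have hsq : ∀ z ∈ K, ∀ w ∈ K, (z.re - w.re) ^ 2 + (z.im - w.im) ^ 2 ≤ 1 := by
    intro z hz w hw
    have := hdiam z hz w hw
    rw [Complex.dist_eq_re_im, Real.sqrt_le_left zero_le_one] at this
    linarith
  have hd0 : ∀ z ∈ K, z.re ^ 2 + z.im ^ 2 ≤ 1 := fun z hz => by simpa using hsq z hz 0 h0
  have hd1 : ∀ z ∈ K, (z.re - 1) ^ 2 + z.im ^ 2 ≤ 1 := fun z hz => by simpa using hsq z hz 1 h1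
  obtain ⟨hc0, s, hs1, hs2, hsT, hsK⟩ :=
    support_line hK hint h0 h1 hd0 hd1 hc hdK hcr hdr hlt
  -- the lower side, by reflection
  obtain ⟨hd0', s', hs1', hs2', hsT', hsK'⟩ : 0 ≤ -d.im ∧ ∃ s : ℝ, 0 ≤ -d.im + s / 2 ∧
      0 ≤ -d.im - s / 2 ∧ ((-d.im) ^ 2 = 3 / 4 → s = 0) ∧
      ∀ z ∈ K, -z.im ≤ -d.im + s * (z.re - 1 / 2) := by
    let e : ℂ ≃ₜ ℂ := Complex.conjLIE.toHomeomorph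
    have he : ∀ z, e z = (starRingEnd ℂ) z := fun z => rfl
    have hfr : e d ∈ frontier (e '' K) := by
      rw [← e.image_frontier]; exact ⟨d, hd, rfl⟩
    have hi : (interior (e '' K)).Nonempty := by
      rw [← e.image_interior]; exact hint.image _
    have hcv : Convex ℝ (e '' K) := hK.linear_image (Complex.conjLIE.toLinearEquiv : ℂ →ₗ[ℝ] ℂ)
    have := support_line (K := e '' K) (c := e d) (d := e c) hcv hi ⟨0, h0, by simp [he]⟩
      ⟨1, h1, by simp [he]⟩ (by rintro _ ⟨z, hz, rfl⟩; simpa [he] using hd0 z hz)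
      (by rintro _ ⟨z, hz, rfl⟩; simpa [he] using hd1 z hz) hfr ⟨c, hcK, rfl⟩
      (by simpa [he] using hdr) (by simpa [he] using hcr) (by simpa [he] using hlt)
    simp only [he, Complex.conj_im, Complex.conj_re, Set.forall_mem_image] at this
    exact this
  have hc34 : c.im ^ 2 ≤ 3 / 4 := by have := hd0 c hcK; rw [hcr] at this; linarith
  have hd34 : (-d.im) ^ 2 ≤ 3 / 4 := by have := hd0 d hdK; rw [hdr] at this; linarith
  obtain ⟨α, β, x₀, x₁, hα0, hβ0, hx, hα, hβ, hseg, hle, hlt1⟩ := half_region hc34 hs1 hs2 hsT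
  obtain ⟨α', β', x₀', x₁', hα0', hβ0', hx', hα', hβ', hseg', hle', hlt1'⟩ :=
    half_region hd34 hs1' hs2' hsT'
  generalize hgh : c.im = h at *
  generalize hgh' : -d.im = h' at *
  have hdim : d.im = -h' := by linarith
  let L : Set ℂ := {z | z.re ^ 2 + z.im ^ 2 ≤ 1 ∧ (z.re - 1) ^ 2 + z.im ^ 2 ≤ 1 ∧
    z.im ≤ h + s * (z.re - 1 / 2) ∧ -z.im ≤ h' + s' * (z.re - 1 / 2)}
  have hKL : K ⊆ L := fun z hz => ⟨hd0 z hz, hd1 z hz, hsK z hz, hsK' z hz⟩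
  have hLb : Bornology.IsBounded L := by
    refine isBounded_iff_forall_norm_le.2 ⟨1, fun z hz => ?_⟩
    have := dist_le_of_sq (z := z) (w := 0) (r := 1) zero_le_one (by simpa using hz.1)
    simpa using this
  have hLc : IsClosed L :=
    IsClosed.and (isClosed_le (by fun_prop) (by fun_prop)) <|
    IsClosed.and (isClosed_le (by fun_prop) (by fun_prop)) <|
    IsClosed.and (isClosed_le (by fun_prop) (by fun_prop)) (isClosed_le (by fun_prop) (by fun_prop))
  let A : Set ℂ := (fun θ : ℝ => (⟨Real.cos θ, Real.sin θ⟩ : ℂ)) '' Set.Icc (-α') α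
  let B : Set ℂ := (fun θ : ℝ => (⟨1 - Real.cos θ, Real.sin θ⟩ : ℂ)) '' Set.Icc (-β') β
  let S : Set ℂ := (fun x : ℝ => (⟨x, h + s * (x - 1 / 2)⟩ : ℂ)) '' Set.Icc x₀ x₁
  let S' : Set ℂ := (fun x : ℝ => (⟨x, (-h') + (-s') * (x - 1 / 2)⟩ : ℂ)) '' Set.Icc x₀' x₁'
  have hfr : frontier L ⊆ (A ∪ B) ∪ (S ∪ S') := by
    intro z hz
    obtain ⟨l1, l2, l3, l4⟩ : z ∈ L := hLc.frontier_subset hz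
    by_cases g1 : z.re ^ 2 + z.im ^ 2 = 1
    · left; left
      obtain ⟨θ, hθ, hre, him⟩ := exists_angle g1 l2
      obtain ⟨hθ1, hθ2⟩ := abs_le.1 hθ
      refine ⟨θ, ⟨?_, ?_⟩, Complex.ext hre.symm him.symm⟩
      · rcases le_total 0 θ with hp | hp
        · linarith
        · have := hα' (-θ) (by linarith) (by linarith)
            (by rw [Real.sin_neg, Real.cos_neg, ← hre, ← him]; exact l4)
          linarith
      · rcases le_total 0 θ with hp | hp
        · exact hα θ hp hθ2 (by rw [← hre, ← him]; exact l3)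
        · linarith
    by_cases g2 : (z.re - 1) ^ 2 + z.im ^ 2 = 1
    · left; right
      obtain ⟨θ, hθ, hre, him⟩ := exists_angle (x := 1 - z.re) (y := z.im)
        (by linarith [sq_abs (z.re - 1), show (1 - z.re) ^ 2 = (z.re - 1) ^ 2 by ring])
        (by linarith [show (1 - z.re - 1) ^ 2 = z.re ^ 2 by ring])
      obtain ⟨hθ1, hθ2⟩ := abs_le.1 hθ
      have hre' : z.re = 1 - Real.cos θ := by linarith
      refine ⟨θ, ⟨?_, ?_⟩, Complex.ext hre'.symm him.symm⟩
      · rcases le_total 0 θ with hp | hp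
        · linarith
        · have := hβ' (-θ) (by linarith) (by linarith)
            (by rw [Real.sin_neg, Real.cos_neg, ← hre', ← him]; exact l4)
          linarith
      · rcases le_total 0 θ with hp | hp
        · exact hβ θ hp hθ2 (by rw [← hre', ← him]; exact l3)
        · linarith
    by_cases g3 : z.im = h + s * (z.re - 1 / 2)
    · right; left
      exact ⟨z.re, hseg z.re (by rw [← g3]; exact l1) (by rw [← g3]; exact l2),
        Complex.ext rfl g3.symm⟩
    by_cases g4 : -z.im = h' + s' * (z.re - 1 / 2)
    · right; right
      exact ⟨z.re, hseg' z.re (by rw [← g4, neg_sq]; exact l1) (by rw [← g4, neg_sq]; exact l2),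
        Complex.ext rfl (show -h' + -s' * (z.re - 1 / 2) = z.im by linarith)⟩
    exfalso
    apply hz.2
    have hopen : IsOpen {z : ℂ | z.re ^ 2 + z.im ^ 2 < 1 ∧ (z.re - 1) ^ 2 + z.im ^ 2 < 1 ∧
        z.im < h + s * (z.re - 1 / 2) ∧ -z.im < h' + s' * (z.re - 1 / 2)} :=
      IsOpen.and (isOpen_lt (by fun_prop) (by fun_prop)) <|
      IsOpen.and (isOpen_lt (by fun_prop) (by fun_prop)) <|
      IsOpen.and (isOpen_lt (by fun_prop) (by fun_prop)) (isOpen_lt (by fun_prop) (by fun_prop))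
    refine interior_maximal (t := {z : ℂ | z.re ^ 2 + z.im ^ 2 < 1 ∧
      (z.re - 1) ^ 2 + z.im ^ 2 < 1 ∧ z.im < h + s * (z.re - 1 / 2) ∧
      -z.im < h' + s' * (z.re - 1 / 2)}) ?_ hopen ?_
    · exact fun w hw => ⟨hw.1.le, hw.2.1.le, hw.2.2.1.le, hw.2.2.2.le⟩
    exact ⟨lt_of_le_of_ne l1 g1, lt_of_le_of_ne l2 g2, lt_of_le_of_ne l3 g3, lt_of_le_of_ne l4 g4⟩
  have hA : μH[1] A ≤ ENNReal.ofReal (1 * (α - -α')) :=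
    hausdorff_curve_le zero_le_one (fun x y => by
      rw [one_mul]
      exact dist_le_of_sq dist_nonneg (arc_dist x y)) (by linarith)
  have hB : μH[1] B ≤ ENNReal.ofReal (1 * (β - -β')) :=
    hausdorff_curve_le zero_le_one (fun x y => by
      rw [one_mul]
      refine dist_le_of_sq dist_nonneg (le_trans (le_of_eq ?_) (arc_dist x y))
      ring) (by linarith)
  have hS : μH[1] S ≤ ENNReal.ofReal (Real.sqrt (1 + s ^ 2) * (x₁ - x₀)) :=
    hausdorff_curve_le (Real.sqrt_nonneg _) (line_dist h s) hx
  have hS' : μH[1] S' ≤ ENNReal.ofReal (Real.sqrt (1 + s' ^ 2) * (x₁' - x₀')) := by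
    rw [← neg_sq s']
    exact hausdorff_curve_le (Real.sqrt_nonneg _) (line_dist (-h') (-s')) hx'
  have q1 : 0 ≤ Real.sqrt (1 + s ^ 2) * (x₁ - x₀) :=
    mul_nonneg (Real.sqrt_nonneg _) (by linarith)
  have q2 : 0 ≤ Real.sqrt (1 + s' ^ 2) * (x₁' - x₀') :=
    mul_nonneg (Real.sqrt_nonneg _) (by linarith)
  calc μH[1] (frontier K) ≤ μH[1] (frontier L) := perimeter_mono hKc hK hint hKL hLb
    _ ≤ μH[1] ((A ∪ B) ∪ (S ∪ S')) := measure_mono hfr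
    _ ≤ (μH[1] A + μH[1] B) + (μH[1] S + μH[1] S') :=
      (measure_union_le _ _).trans (add_le_add (measure_union_le _ _) (measure_union_le _ _))
    _ ≤ (ENNReal.ofReal (1 * (α - -α')) + ENNReal.ofReal (1 * (β - -β'))) +
        (ENNReal.ofReal (Real.sqrt (1 + s ^ 2) * (x₁ - x₀)) +
          ENNReal.ofReal (Real.sqrt (1 + s' ^ 2) * (x₁' - x₀'))) := by gcongr
    _ = ENNReal.ofReal ((1 * (α - -α') + 1 * (β - -β')) +
        (Real.sqrt (1 + s ^ 2) * (x₁ - x₀) + Real.sqrt (1 + s' ^ 2) * (x₁' - x₀'))) := by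
      rw [ENNReal.ofReal_add (by linarith) (by linarith), ENNReal.ofReal_add (by linarith)
        (by linarith), ENNReal.ofReal_add q1 q2]
    _ < _ := by
      rw [ENNReal.ofReal_lt_ofReal_iff (by linarith)]
      rcases eq_or_lt_of_le hc0 with hz | hz
      · have := hlt1' (by linarith)
        linarith
      · have := hlt1 hz
        linarith

/-- If `ab` is a diameter of a planar compact convex body `K` and the perpendicular
bisector of `ab` meets `∂K` at the two points `c ≠ d`, then
`per K < 2|ab| + 2|cd|`. -/
theorem stmt2 (K : Set (EuclideanSpace ℝ (Fin 2)))
    (hKc : IsCompact K) (hKconv : Convex ℝ K) (hKint : (interior K).Nonempty)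
    (a b c d : EuclideanSpace ℝ (Fin 2))
    (ha : a ∈ K) (hb : b ∈ K) (hab : dist a b = diam K)
    (hc : c ∈ frontier K) (hd : d ∈ frontier K) (hcd : c ≠ d)
    (hcbis : dist c a = dist c b) (hdbis : dist d a = dist d b) :
    μH[1] (frontier K) < ENNReal.ofReal (2 * dist a b + 2 * dist c d) := by
  have hcK : c ∈ K := hKc.isClosed.frontier_subset hc
  have hdK : d ∈ K := hKc.isClosed.frontier_subset hd
  have hD : 0 < dist a b := by
    rw [hab]
    exact (dist_pos.2 hcd).trans_le (dist_le_diam_of_mem hKc.isBounded hcK hdK)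
  let R : EuclideanSpace ℝ (Fin 2) ≃ₗᵢ[ℝ] ℂ := Complex.orthonormalBasisOneI.repr.symm
  let w : ℂ := R b - R a
  have hwn : ‖w‖ = dist a b := by
    rw [← dist_eq_norm, R.dist_map, dist_comm]
  have hw : w ≠ 0 := by
    intro h0; rw [h0, norm_zero] at hwn; linarith
  -- the normalising similarity
  let e : EuclideanSpace ℝ (Fin 2) ≃ₜ ℂ :=
    (R.toHomeomorph.trans (Homeomorph.subRight (R a))).trans (Homeomorph.mulRight₀ w⁻¹ (inv_ne_zero hw))
  have he : ∀ x, e x = (R x - R a) * w⁻¹ := fun x => rfl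
  have hdist : ∀ x y, dist (e x) (e y) = dist x y / dist a b := by
    intro x y
    rw [dist_eq_norm, he, he, ← sub_mul, sub_sub_sub_cancel_right, norm_mul, norm_inv, hwn,
      ← dist_eq_norm, R.dist_map]
    rfl
  have hea : e a = 0 := by simp [he]
  have heb : e b = 1 := by rw [he]; exact mul_inv_cancel₀ hw
  have hconv : Convex ℝ (e '' K) := by
    rintro _ ⟨x, hx, rfl⟩ _ ⟨y, hy, rfl⟩ r t hr ht hrt
    refine ⟨r • x + t • y, hKconv hx hy hr ht hrt, ?_⟩
    rw [he, he, he, map_add, map_smul, map_smul]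
    simp only [Complex.real_smul]
    have : (r : ℂ) + t = 1 := by exact_mod_cast hrt
    linear_combination (R a * w⁻¹) * this
  have hint : (interior (e '' K)).Nonempty := by
    rw [← e.image_interior]; exact hKint.image _
  have hcomp : IsCompact (e '' K) := hKc.image e.continuous
  have hdm : ∀ z ∈ e '' K, ∀ u ∈ e '' K, dist z u ≤ 1 := by
    rintro _ ⟨x, hx, rfl⟩ _ ⟨y, hy, rfl⟩
    rw [hdist, div_le_one hD, hab]
    exact dist_le_diam_of_mem hKc.isBounded hx hy
  have hre : ∀ x, dist x a = dist x b → (e x).re = 1 / 2 := by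
    intro x hx
    have : dist (e x) (e a) = dist (e x) (e b) := by rw [hdist, hdist, hx]
    rw [hea, heb, Complex.dist_eq_re_im, Complex.dist_eq_re_im, Real.sqrt_inj (by positivity)
      (by positivity)] at this
    simp at this
    linarith
  have hfr : frontier (e '' K) = e '' frontier K := (e.image_frontier K).symm
  have hmain : μH[1] (frontier (e '' K)) < ENNReal.ofReal (2 + 2 * dist (e c) (e d)) := by
    have hcr := hre c hcbis
    have hdr := hre d hdbis
    have hcf : e c ∈ frontier (e '' K) := by rw [hfr]; exact ⟨c, hc, rfl⟩
    have hdf : e d ∈ frontier (e '' K) := by rw [hfr]; exact ⟨d, hd, rfl⟩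
    have hdd : dist (e c) (e d) = |(e c).im - (e d).im| := by
      rw [Complex.dist_eq_re_im, hcr, hdr, sub_self, zero_pow two_ne_zero, zero_add,
        Real.sqrt_sq_eq_abs]
    rcases lt_trichotomy (e c).im (e d).im with h | h | h
    · rw [hdd, abs_of_neg (by linarith), neg_sub]
      exact normalized hcomp hconv hint ⟨a, ha, hea⟩ ⟨b, hb, heb⟩ hdm hdf hcf hdr hcr h
    · exact absurd (e.injective (Complex.ext (hcr.trans hdr.symm) h)) hcd
    · rw [hdd, abs_of_pos (by linarith)]
      exact normalized hcomp hconv hint ⟨a, ha, hea⟩ ⟨b, hb, heb⟩ hdm hcf hdf hcr hdr h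
  -- scale back
  have hlip : LipschitzWith (dist a b).toNNReal e.symm := by
    refine LipschitzWith.of_dist_le_mul fun x y => le_of_eq ?_
    have := hdist (e.symm x) (e.symm y)
    rw [e.apply_symm_apply, e.apply_symm_apply] at this
    rw [this]
    rw [Real.coe_toNNReal _ hD.le]
    field_simp
  have himg : frontier K = e.symm '' frontier (e '' K) := by
    rw [hfr, ← Set.image_comp]; simp
  calc μH[1] (frontier K) = μH[1] (e.symm '' frontier (e '' K)) := by rw [← himg]
    _ ≤ ENNReal.ofReal (dist a b) * μH[1] (frontier (e '' K)) := by
      have := hlip.hausdorffMeasure_image_le (d := 1) zero_le_one (frontier (e '' K))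
      rwa [ENNReal.rpow_one] at this
    _ < ENNReal.ofReal (dist a b) * ENNReal.ofReal (2 + 2 * dist (e c) (e d)) :=
      ENNReal.mul_lt_mul_right (by simpa using hD) ENNReal.ofReal_ne_top hmain
    _ = _ := by
      rw [← ENNReal.ofReal_mul hD.le, hdist]
      congr 1
      field_simp
end

section
/- For every compact convex set K in the plane with nonempty interior, there exist four points on the boundary of K such that every rectifiable curve passing through all four points has length at least half the perimeter of K. -/
open Set MeasureTheory

lemma exists_proj {E : Type*} [NormedAddCommGroup E] [InnerProductSpace ℝ E] {K : Set E}
    (hKc : IsCompact K) (hK : Convex ℝ K) (hne : K.Nonempty) :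
    ∃ f : E → E, LipschitzWith 1 f ∧ ∀ p ∈ K, ∀ n : E, (∀ x ∈ K, inner ℝ n (x - p) ≤ 0) →
      f (p + n) = p := by
  have h1 : ∀ u : E, ∃ v ∈ K, ∀ w ∈ K, inner ℝ (u - v) (w - v) ≤ 0 := by
    intro u
    obtain ⟨v, hv, h⟩ := exists_norm_eq_iInf_of_complete_convex hne hKc.isComplete hK u
    exact ⟨v, hv, (norm_eq_iInf_iff_real_inner_le_zero hK hv).1 h⟩
  choose f hf hf2 using h1
  have key : ∀ u₁ u₂ v₁ v₂ : E, inner ℝ (u₁ - v₁) (v₂ - v₁) ≤ 0 → inner ℝ (u₂ - v₂) (v₁ - v₂) ≤ 0 →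
      ‖v₁ - v₂‖ ≤ ‖u₁ - u₂‖ := by
    intro u₁ u₂ v₁ v₂ h1 h2
    have h3 : inner ℝ (u₁ - v₁) (v₂ - v₁) + inner ℝ (u₂ - v₂) (v₁ - v₂)
        = inner ℝ (v₁ - v₂) (v₁ - v₂) - inner ℝ (u₁ - u₂) (v₁ - v₂) := by
      simp only [inner_sub_left, inner_sub_right]; ring
    have h4 := real_inner_le_norm (u₁ - u₂) (v₁ - v₂)
    rw [real_inner_self_eq_norm_sq] at h3
    by_contra hlt
    push Not at hlt
    have : 0 < ‖v₁ - v₂‖ := (norm_nonneg _).trans_lt hlt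
    nlinarith
  refine ⟨f, LipschitzWith.of_dist_le_mul fun u v => ?_, ?_⟩
  · rw [dist_eq_norm, dist_eq_norm]
    simpa using key u v (f u) (f v) (hf2 u _ (hf v)) (hf2 v _ (hf u))
  · intro p hp n hn
    have := key (p + n) (p + n) (f (p + n)) p (hf2 _ _ hp) (by simpa using hn _ (hf _))
    simp only [sub_self, norm_zero, norm_le_zero_iff] at this
    exact sub_eq_zero.1 this

lemma exists_support {E : Type*} [NormedAddCommGroup E] [InnerProductSpace ℝ E] [CompleteSpace E]
    {K : Set E} (hK : Convex ℝ K) (hint : (interior K).Nonempty) {p : E} (hp : p ∈ frontier K) :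
    ∃ n : E, n ≠ 0 ∧ ∀ x ∈ K, inner ℝ n (x - p) ≤ 0 := by
  obtain ⟨f, hf⟩ := geometric_hahn_banach_open_point hK.interior isOpen_interior hp.2
  refine ⟨(InnerProductSpace.toDual ℝ E).symm f, ?_, ?_⟩
  · intro h
    obtain ⟨a, ha⟩ := hint
    have h0 : f = 0 := by simpa using h
    have := hf a ha
    simp [h0] at this
  · intro x hx
    rw [InnerProductSpace.toDual_symm_apply, map_sub, sub_nonpos]
    have hx' : x ∈ closure (interior K) := by
      rw [hK.closure_interior_eq_closure_of_nonempty_interior hint]; exact subset_closure hx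
    have hcl : IsClosed {x | f x ≤ f p} := isClosed_le f.continuous continuous_const
    exact closure_minimal (fun a ha => (hf a ha).le) hcl hx'

lemma perim_le {E : Type*} [NormedAddCommGroup E] [InnerProductSpace ℝ E] [CompleteSpace E]
    [MeasurableSpace E] [BorelSpace E]
    {K : Set E} (hKc : IsCompact K) (hK : Convex ℝ K) (hint : (interior K).Nonempty)
    {ι : Type*} [Fintype ι] (f : ι → E → ℝ) (hf : ∀ i, Continuous (f i))
    (hfK : ∀ i, ∀ p ∈ K, f i p ≤ 0) (C : ℝ) (hb : ∀ p, (∀ i, f i p ≤ 0) → ‖p‖ ≤ C)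
    (l : ι → ENNReal) (hl : ∀ i, μH[1] {p | (∀ j, f j p ≤ 0) ∧ f i p = 0} ≤ l i) :
    μH[1] (frontier K) ≤ ∑ i, l i := by
  obtain ⟨g, hg, hgp⟩ := exists_proj hKc hK (hint.mono interior_subset)
  set S : Set E := ⋃ i, {p | (∀ j, f j p ≤ 0) ∧ f i p = 0} with hS
  have hsub : frontier K ⊆ g '' S := by
    intro p hp
    obtain ⟨n, hn0, hn⟩ := exists_support hK hint hp
    have hpK : p ∈ K := hKc.isClosed.frontier_subset hp
    set Q : Set E := {p | ∀ i, f i p ≤ 0} with hQ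
    have hQc : IsClosed Q := by
      rw [hQ, Set.ofPred_forall]
      exact isClosed_iInter fun i => isClosed_le (hf i) continuous_const
    have hray : ((fun t : ℝ => p + t • n) '' Ici 0 ∩ frontier Q).Nonempty := by
      by_contra hemp
      have hpre : IsPreconnected ((fun t : ℝ => p + t • n) '' Ici 0) :=
        (isPreconnected_Ici).image _ (by fun_prop)
      have hpQ : p ∈ Q := fun i => hfK i p hpK
      have hcov : (fun t : ℝ => p + t • n) '' Ici 0 ⊆ interior Q ∪ Qᶜ := by
        intro x hx
        by_cases hxQ : x ∈ Q
        · left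
          by_contra hxi
          exact hemp ⟨x, hx, subset_closure hxQ, hxi⟩
        · exact Or.inr hxQ
      have hp0 : p ∈ (fun t : ℝ => p + t • n) '' Ici 0 := ⟨0, by simp, by simp⟩
      have hout : ((fun t : ℝ => p + t • n) '' Ici 0 ∩ Qᶜ).Nonempty := by
        have hn' : 0 < ‖n‖ := norm_pos_iff.2 hn0
        have hC : 0 ≤ C := (norm_nonneg p).trans (hb p fun i => hfK i p hpK)
        refine ⟨p + ((C + 1 + ‖p‖) / ‖n‖) • n, ⟨_, ?_, rfl⟩, ?_⟩
        · simp only [mem_Ici]; positivity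
        · intro hmem
          have h1 := hb _ hmem
          have h2 : ‖((C + 1 + ‖p‖) / ‖n‖) • n‖ = C + 1 + ‖p‖ := by
            rw [norm_smul, Real.norm_of_nonneg (by positivity)]; field_simp
          have h3 := norm_sub_le (p + ((C + 1 + ‖p‖) / ‖n‖) • n) p
          rw [add_sub_cancel_left, h2] at h3
          linarith
      obtain ⟨x, -, hx1, hx2⟩ := hpre _ _ isOpen_interior hQc.isOpen_compl hcov
        ⟨p, hp0, (hcov hp0).resolve_right fun h => h hpQ⟩ hout
      exact hx2 (interior_subset hx1)
    obtain ⟨x, ⟨t, ht, rfl⟩, hx⟩ := hray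
    have hxQ : (p + t • n) ∈ Q := hQc.frontier_subset hx
    refine ⟨p + t • n, ?_, hgp p hpK (t • n) ?_⟩
    · rw [hS, mem_iUnion]
      by_contra hcon
      push Not at hcon
      apply hx.2
      rw [mem_interior_iff_mem_nhds]
      have : ∀ i, ∀ᶠ y in nhds (p + t • n), f i y ≤ 0 := by
        intro i
        have hlt : f i (p + t • n) < 0 :=
          lt_of_le_of_ne (hxQ i) fun h => hcon i ⟨hxQ, h⟩
        exact ((hf i).continuousAt.eventually_lt continuousAt_const hlt).mono fun _ h => le_of_lt h
      exact Filter.eventually_all.2 this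
    · intro x hx
      rw [real_inner_smul_left]
      exact mul_nonpos_of_nonneg_of_nonpos ht (hn x hx)
  calc μH[1] (frontier K) ≤ μH[1] (g '' S) := measure_mono hsub
    _ ≤ μH[1] S := by
        have := hg.hausdorffMeasure_image_le (d := 1) zero_le_one S
        simpa using this
    _ ≤ ∑ i, μH[1] {p | (∀ j, f j p ≤ 0) ∧ f i p = 0} := measure_iUnion_fintype_le _ _
    _ ≤ ∑ i, l i := Finset.sum_le_sum fun i _ => hl i

lemma edge_le (S : Set (EuclideanSpace ℝ (Fin 2))) (a b u v α β k : ℝ) (hk : 0 ≤ k)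
    (hkk : u ^ 2 + v ^ 2 ≤ k ^ 2)
    (h : ∀ p ∈ S, ∃ t, α ≤ t ∧ t ≤ β ∧ p 0 = a + t * u ∧ p 1 = b + t * v) :
    μH[1] S ≤ ENNReal.ofReal (k * (β - α)) := by
  let g : ℝ → EuclideanSpace ℝ (Fin 2) := fun t => !₂[a + t * u, b + t * v]
  have hg : LipschitzWith (Real.toNNReal k) g := by
    apply LipschitzWith.of_dist_le_mul
    intro s t
    rw [EuclideanSpace.dist_eq, Real.coe_toNNReal _ hk, Real.dist_eq]
    apply Real.sqrt_le_iff.2 ⟨by positivity, ?_⟩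
    simp only [Fin.sum_univ_two, g, Real.dist_eq, sq_abs, mul_pow]
    simp
    nlinarith [mul_le_mul_of_nonneg_right hkk (sq_nonneg (s - t))]
  have hsub : S ⊆ g '' Icc α β := by
    intro p hp
    obtain ⟨t, h1, h2, h3, h4⟩ := h p hp
    refine ⟨t, ⟨h1, h2⟩, ?_⟩
    ext i
    fin_cases i
    · simp [g, h3]
    · simp [g, h4]
  calc μH[1] S ≤ μH[1] (g '' Icc α β) := measure_mono hsub
    _ ≤ _ := hg.hausdorffMeasure_image_le zero_le_one _
    _ = _ := by
      rw [hausdorffMeasure_real, Real.volume_Icc, ENNReal.rpow_one, ENNReal.ofReal_mul hk]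
      rfl

lemma path_le {E : Type*} [PseudoMetricSpace E] (γ : ℝ → E) {a b c d : ℝ} (ha : a ∈ Icc (0 : ℝ) 1)
    (hd : d ∈ Icc (0 : ℝ) 1) (hab : a ≤ b) (hbc : b ≤ c) (hcd : c ≤ d) {M : ℝ}
    (hM : M ≤ dist (γ a) (γ b) + dist (γ b) (γ c) + dist (γ c) (γ d)) :
    ENNReal.ofReal M ≤ eVariationOn γ (Icc 0 1) := by
  have hb : b ∈ Icc (0 : ℝ) 1 := ⟨ha.1.trans hab, hbc.trans (hcd.trans hd.2)⟩
  have hc : c ∈ Icc (0 : ℝ) 1 := ⟨hb.1.trans hbc, hcd.trans hd.2⟩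
  have e1 : edist (γ a) (γ b) ≤ eVariationOn γ (Icc 0 1 ∩ Icc a b) :=
    eVariationOn.edist_le _ ⟨ha, le_rfl, hab⟩ ⟨hb, hab, le_rfl⟩
  have e2 : edist (γ b) (γ c) ≤ eVariationOn γ (Icc 0 1 ∩ Icc b c) :=
    eVariationOn.edist_le _ ⟨hb, le_rfl, hbc⟩ ⟨hc, hbc, le_rfl⟩
  have e3 : edist (γ c) (γ d) ≤ eVariationOn γ (Icc 0 1 ∩ Icc c d) :=
    eVariationOn.edist_le _ ⟨hc, le_rfl, hcd⟩ ⟨hd, hcd, le_rfl⟩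
  calc ENNReal.ofReal M ≤ edist (γ a) (γ b) + edist (γ b) (γ c) + edist (γ c) (γ d) := by
        rw [edist_dist, edist_dist, edist_dist, ← ENNReal.ofReal_add dist_nonneg dist_nonneg,
          ← ENNReal.ofReal_add (by positivity) dist_nonneg]
        exact ENNReal.ofReal_le_ofReal hM
    _ ≤ _ := add_le_add (add_le_add e1 e2) e3
    _ = eVariationOn γ (Icc 0 1 ∩ Icc a d) := by
        rw [eVariationOn.Icc_add_Icc γ hab hbc hb, eVariationOn.Icc_add_Icc γ (hab.trans hbc) hcd hc]
    _ ≤ _ := eVariationOn.mono γ inter_subset_left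

lemma real_ineq (c τ β a b H : ℝ) (hc : 0 < c) (hβ : 0 ≤ β) (ha : 0 ≤ a) (hb : 0 ≤ b)
    (ha2 : a ^ 2 = c ^ 2 + τ ^ 2) (hb2 : b ^ 2 = c ^ 2 + β ^ 2)
    (h1 : H ≤ τ + β + a + b) (h2 : H ≤ 3.32 * c) : H ≤ a + 2 * b := by
  by_cases h : τ + β ≤ b
  · linarith
  · push Not at h
    have h3 : 0.8 * c + 0.6 * τ ≤ a := by
      apply le_of_sq_le_sq _ ha
      nlinarith [sq_nonneg (0.6 * c - 0.8 * τ)]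
    have h4 : 2.52 * c + 0.6 * β ≤ 2.6 * b := by
      apply le_of_sq_le_sq _ (by positivity)
      nlinarith [sq_nonneg (0.236 * c - β), sq_nonneg β, sq_nonneg c]
    linarith

lemma norm_le_abs (p : EuclideanSpace ℝ (Fin 2)) : ‖p‖ ≤ |p 0| + |p 1| := by
  rw [EuclideanSpace.norm_eq]
  apply Real.sqrt_le_iff.2 ⟨by positivity, ?_⟩
  simp only [Fin.sum_univ_two, Real.norm_eq_abs]
  nlinarith [mul_nonneg (abs_nonneg (p 0)) (abs_nonneg (p 1))]

lemma interior_move {K : Set (EuclideanSpace ℝ (Fin 2))} {p : EuclideanSpace ℝ (Fin 2)}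
    (hp : p ∈ interior K) (v : EuclideanSpace ℝ (Fin 2)) : ∃ t : ℝ, 0 < t ∧ p + t • v ∈ K := by
  have hc : ContinuousAt (fun t : ℝ => p + t • v) 0 := by fun_prop
  have h1 : ∀ᶠ t : ℝ in nhds 0, p + t • v ∈ K := by
    apply hc.eventually_mem
    simpa using mem_interior_iff_mem_nhds.1 hp
  have h2 : ∀ᶠ t : ℝ in nhdsWithin 0 (Ioi 0), p + t • v ∈ K := h1.filter_mono nhdsWithin_le_nhds
  obtain ⟨t, ht, ht'⟩ := (h2.and self_mem_nhdsWithin).exists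
  exact ⟨t, ht', ht⟩

lemma trap_bound {K : Set (EuclideanSpace ℝ (Fin 2))}
    (hKc : IsCompact K) (hK : Convex ℝ K) (hint : (interior K).Nonempty)
    (c τ β a b m₁ m₂ : ℝ) (hc : 0 < c) (ha : 0 ≤ a) (hb : 0 ≤ b)
    (ha2 : a ^ 2 = c ^ 2 + τ ^ 2) (hb2 : b ^ 2 = c ^ 2 + β ^ 2)
    (h1 : |m₁| * c ≤ τ) (h2 : |m₂| * c ≤ β)
    (hX : ∀ p ∈ K, -c ≤ p 0 ∧ p 0 ≤ c)
    (hT : ∀ p ∈ K, p 1 ≤ τ + m₁ * p 0) (hB : ∀ p ∈ K, -β + m₂ * p 0 ≤ p 1) :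
    μH[1] (frontier K) ≤ ENNReal.ofReal (2 * (τ + β + a + b)) := by
  have hm1 : m₁ * c ≤ τ ∧ -τ ≤ m₁ * c := by
    constructor <;> nlinarith [le_abs_self m₁, neg_abs_le m₁]
  have hm2 : m₂ * c ≤ β ∧ -β ≤ m₂ * c := by
    constructor <;> nlinarith [le_abs_self m₂, neg_abs_le m₂]
  have hsl : ∀ m t d : ℝ, 0 ≤ d → d ^ 2 = c ^ 2 + t ^ 2 → m * c ≤ t → -t ≤ m * c →
      1 ^ 2 + m ^ 2 ≤ (d / c) ^ 2 := by
    intro m t d hd hd2 h3 h4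
    rw [div_pow, le_div_iff₀ (by positivity)]
    nlinarith [mul_nonneg (sub_nonneg.2 h3) (sub_nonneg.2 h4)]
  have key := perim_le hKc hK hint
    (![fun p => p 0 - c, fun p => -c - p 0, fun p => p 1 - τ - m₁ * p 0,
      fun p => -β + m₂ * p 0 - p 1] : Fin 4 → EuclideanSpace ℝ (Fin 2) → ℝ)
    (by
      intro i
      fin_cases i <;> simp <;> fun_prop)
    (by
      intro i p hp
      have := hX p hp
      have := hT p hp
      have := hB p hp
      fin_cases i <;> simp <;> linarith)
    (c + (2 * τ + 2 * β))
    (by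
      intro p hp
      have e0 := hp 0
      have e1 := hp 1
      have e2 := hp 2
      have e3 := hp 3
      simp at e0 e1 e2 e3
      have e4 : |p 0| ≤ c := abs_le.2 ⟨by linarith, by linarith⟩
      have e5 : |m₁ * p 0| ≤ τ := by
        rw [abs_mul]; exact (mul_le_mul_of_nonneg_left e4 (abs_nonneg _)).trans h1
      have e6 : |m₂ * p 0| ≤ β := by
        rw [abs_mul]; exact (mul_le_mul_of_nonneg_left e4 (abs_nonneg _)).trans h2
      rw [abs_le] at e5 e6
      have e7 : |p 1| ≤ 2 * τ + 2 * β := abs_le.2 ⟨by linarith, by linarith⟩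
      linarith [norm_le_abs p])
    (![ENNReal.ofReal (1 * ((τ + m₁ * c) - (-β + m₂ * c))),
      ENNReal.ofReal (1 * ((τ - m₁ * c) - (-β - m₂ * c))),
      ENNReal.ofReal (a / c * (c - (-c))), ENNReal.ofReal (b / c * (c - (-c)))])
    (by
      intro i
      fin_cases i
      · apply edge_le _ c 0 0 1 _ _ _ zero_le_one (by norm_num)
        rintro p ⟨hp, hp0⟩
        have e2 := hp 2
        have e3 := hp 3
        simp at e2 e3 hp0
        have : p 0 = c := by linarith
        rw [this] at e2 e3
        exact ⟨p 1, by linarith, by linarith, by linarith, by linarith⟩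
      · apply edge_le _ (-c) 0 0 1 _ _ _ zero_le_one (by norm_num)
        rintro p ⟨hp, hp0⟩
        have e2 := hp 2
        have e3 := hp 3
        simp at e2 e3 hp0
        have : p 0 = -c := by linarith
        rw [this] at e2 e3
        exact ⟨p 1, by linarith, by linarith, by linarith, by linarith⟩
      · apply edge_le _ 0 τ 1 m₁ _ _ _ (by positivity) (hsl m₁ τ a ha ha2 hm1.1 hm1.2)
        rintro p ⟨hp, hp0⟩
        have e0 := hp 0
        have e1 := hp 1
        simp at e0 e1 hp0
        exact ⟨p 0, by linarith, by linarith, by linarith, by linarith⟩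
      · apply edge_le _ 0 (-β) 1 m₂ _ _ _ (by positivity) (hsl m₂ β b hb hb2 hm2.1 hm2.2)
        rintro p ⟨hp, hp0⟩
        have e0 := hp 0
        have e1 := hp 1
        simp at e0 e1 hp0
        exact ⟨p 0, by linarith, by linarith, by linarith, by linarith⟩)
  refine key.trans (le_of_eq ?_)
  have f1 : a / c * (c - (-c)) = 2 * a := by field_simp; ring
  have f2 : b / c * (c - (-c)) = 2 * b := by field_simp; ring
  rw [f1, f2]
  simp only [Fin.sum_univ_four]
  simp only [Matrix.cons_val]
  rw [← ENNReal.ofReal_add (by linarith) (by linarith), ← ENNReal.ofReal_add (by linarith) (by linarith),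
    ← ENNReal.ofReal_add (by linarith) (by linarith)]
  congr 1
  ring

lemma oct_bound {K : Set (EuclideanSpace ℝ (Fin 2))}
    (hKc : IsCompact K) (hK : Convex ℝ K) (hint : (interior K).Nonempty)
    (c : ℝ) (hc : 0 < c) (hX : ∀ p ∈ K, -c ≤ p 0 ∧ p 0 ≤ c)
    (hL : !₂[-c, 0] ∈ K) (hR : !₂[c, 0] ∈ K)
    (hD : ∀ p ∈ K, ∀ q ∈ K, (p 0 - q 0) ^ 2 + (p 1 - q 1) ^ 2 ≤ (2 * c) ^ 2) :
    μH[1] (frontier K) ≤ ENNReal.ofReal (6.64 * c) := by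
  have hne : K.Nonempty := ⟨_, hL⟩
  have cmax : ∀ f : EuclideanSpace ℝ (Fin 2) → ℝ, Continuous f → ∃ p ∈ K, ∀ q ∈ K, f q ≤ f p := by
    intro f hf
    obtain ⟨p, hp, h⟩ := hKc.exists_isMaxOn hne hf.continuousOn
    exact ⟨p, hp, fun q hq => h hq⟩
  obtain ⟨A, hA, hA'⟩ := cmax (fun p => p 1) (by fun_prop)
  obtain ⟨B, hB, hB'⟩ := cmax (fun p => - p 1) (by fun_prop)
  obtain ⟨U, hU, hU'⟩ := cmax (fun p => p 0 + p 1) (by fun_prop)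
  obtain ⟨U', hU1, hU1'⟩ := cmax (fun p => -(p 0 + p 1)) (by fun_prop)
  obtain ⟨V, hV, hV'⟩ := cmax (fun p => p 0 - p 1) (by fun_prop)
  obtain ⟨V', hV1, hV1'⟩ := cmax (fun p => -(p 0 - p 1)) (by fun_prop)
  simp only at hA' hB' hU' hU1' hV' hV1'
  obtain ⟨s, hs, hs2⟩ : ∃ s : ℝ, 0 ≤ s ∧ s ^ 2 = 2 := ⟨√2, by positivity, by norm_num⟩
  have hs3 : s ≤ 1.415 := by nlinarith
  have hs4 : 1 ≤ s := by nlinarith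
  generalize hy1 : A 1 = y1 at *
  generalize hy0 : B 1 = y0 at *
  generalize hu1 : U 0 + U 1 = u1 at *
  generalize hu0 : U' 0 + U' 1 = u0 at *
  generalize hv1 : V 0 - V 1 = v1 at *
  generalize hv0 : V' 0 - V' 1 = v0 at *
  have wY : y1 - y0 ≤ 2 * c := by
    apply le_of_sq_le_sq _ (by positivity)
    have := hD A hA B hB
    rw [← hy1, ← hy0]
    nlinarith [sq_nonneg (A 0 - B 0)]
  have wU : u1 - u0 ≤ s * (2 * c) := by
    apply le_of_sq_le_sq _ (by positivity)
    have := hD U hU U' hU1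
    rw [← hu1, ← hu0, mul_pow, hs2]
    nlinarith [sq_nonneg ((U 0 - U' 0) - (U 1 - U' 1))]
  have wV : v1 - v0 ≤ s * (2 * c) := by
    apply le_of_sq_le_sq _ (by positivity)
    have := hD V hV V' hV1
    rw [← hv1, ← hv0, mul_pow, hs2]
    nlinarith [sq_nonneg ((V 0 - V' 0) + (V 1 - V' 1))]
  have n1 : 0 ≤ u1 + v1 - 2 * c := by
    have e1 := hU' _ hR
    have e2 := hV' _ hR
    simp at e1 e2
    linarith
  have n2 : 0 ≤ -u0 - v0 - 2 * c := by
    have e1 := hU1' _ hL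
    have e2 := hV1' _ hL
    simp at e1 e2
    linarith
  have n3 : 0 ≤ u1 - v0 - 2 * y1 := by linarith [hU' A hA, hV1' A hA]
  have n4 : 0 ≤ v1 - u0 + 2 * y0 := by linarith [hV' B hB, hU1' B hB]
  have n5 : 0 ≤ s * (c + y1 - u1) := mul_nonneg hs (by linarith [hX U hU, hA' U hU])
  have n6 : 0 ≤ s * (u0 - y0 + c) := mul_nonneg hs (by linarith [hX U' hU1, hB' U' hU1])
  have n7 : 0 ≤ s * (c - v1 - y0) := mul_nonneg hs (by linarith [hX V hV, hB' V hV])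
  have n8 : 0 ≤ s * (v0 + y1 + c) := mul_nonneg hs (by linarith [hX V' hV1, hA' V' hV1])
  have key := perim_le hKc hK hint
    (![fun p => p 0 - c, fun p => -c - p 0, fun p => p 1 - y1, fun p => y0 - p 1,
      fun p => p 0 + p 1 - u1, fun p => u0 - (p 0 + p 1),
      fun p => p 0 - p 1 - v1, fun p => v0 - (p 0 - p 1)] : Fin 8 → EuclideanSpace ℝ (Fin 2) → ℝ)
    (by
      intro i
      fin_cases i <;> simp <;> fun_prop)
    (by
      intro i p hp
      have := hX p hp
      have := hA' p hp
      have := hB' p hp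
      have := hU' p hp
      have := hU1' p hp
      have := hV' p hp
      have := hV1' p hp
      fin_cases i <;> simp <;> linarith)
    (c + (|y0| + |y1|))
    (by
      intro p hp
      have e0 := hp 0
      have e1 := hp 1
      have e2 := hp 2
      have e3 := hp 3
      simp at e0 e1 e2 e3
      have e4 : |p 0| ≤ c := abs_le.2 ⟨by linarith, by linarith⟩
      have e7 : |p 1| ≤ |y0| + |y1| :=
        abs_le.2 ⟨by linarith [neg_abs_le y0, abs_nonneg y1], by linarith [le_abs_self y1, abs_nonneg y0]⟩
      linarith [norm_le_abs p])
    (![ENNReal.ofReal (1 * ((u1 - c) - (c - v1))), ENNReal.ofReal (1 * ((-c - v0) - (u0 + c))),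
      ENNReal.ofReal (1 * ((u1 - y1) - (v0 + y1))), ENNReal.ofReal (1 * ((v1 + y0) - (u0 - y0))),
      ENNReal.ofReal (s * (c - (u1 - y1))), ENNReal.ofReal (s * ((u0 - y0) - (-c))),
      ENNReal.ofReal (s * (c - (v1 + y0))), ENNReal.ofReal (s * ((v0 + y1) - (-c)))])
    (by
      intro i
      fin_cases i
      · apply edge_le _ c 0 0 1 _ _ _ zero_le_one (by norm_num)
        rintro p ⟨hp, hp0⟩
        have e2 := hp 4
        have e3 := hp 6
        simp at e2 e3 hp0
        exact ⟨p 1, by linarith, by linarith, by linarith, by linarith⟩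
      · apply edge_le _ (-c) 0 0 1 _ _ _ zero_le_one (by norm_num)
        rintro p ⟨hp, hp0⟩
        have e2 := hp 5
        have e3 := hp 7
        simp at e2 e3 hp0
        exact ⟨p 1, by linarith, by linarith, by linarith, by linarith⟩
      · apply edge_le _ 0 y1 1 0 _ _ _ zero_le_one (by norm_num)
        rintro p ⟨hp, hp0⟩
        have e2 := hp 4
        have e3 := hp 7
        simp at e2 e3 hp0
        exact ⟨p 0, by linarith, by linarith, by linarith, by linarith⟩
      · apply edge_le _ 0 y0 1 0 _ _ _ zero_le_one (by norm_num)
        rintro p ⟨hp, hp0⟩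
        have e2 := hp 5
        have e3 := hp 6
        simp at e2 e3 hp0
        exact ⟨p 0, by linarith, by linarith, by linarith, by linarith⟩
      · apply edge_le _ 0 u1 1 (-1) _ _ _ hs (by linarith)
        rintro p ⟨hp, hp0⟩
        have e2 := hp 0
        have e3 := hp 2
        simp at e2 e3 hp0
        exact ⟨p 0, by linarith, by linarith, by linarith, by linarith⟩
      · apply edge_le _ 0 u0 1 (-1) _ _ _ hs (by linarith)
        rintro p ⟨hp, hp0⟩
        have e2 := hp 1
        have e3 := hp 3
        simp at e2 e3 hp0
        exact ⟨p 0, by linarith, by linarith, by linarith, by linarith⟩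
      · apply edge_le _ 0 (-v1) 1 1 _ _ _ hs (by linarith)
        rintro p ⟨hp, hp0⟩
        have e2 := hp 0
        have e3 := hp 3
        simp at e2 e3 hp0
        exact ⟨p 0, by linarith, by linarith, by linarith, by linarith⟩
      · apply edge_le _ 0 (-v0) 1 1 _ _ _ hs (by linarith)
        rintro p ⟨hp, hp0⟩
        have e2 := hp 1
        have e3 := hp 2
        simp at e2 e3 hp0
        exact ⟨p 0, by linarith, by linarith, by linarith, by linarith⟩)
  refine key.trans ?_
  simp only [Fin.sum_univ_eight]
  simp only [Matrix.cons_val]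
  rw [← ENNReal.ofReal_add (by linarith) (by linarith), ← ENNReal.ofReal_add (by linarith) (by linarith),
    ← ENNReal.ofReal_add (by linarith) (by linarith), ← ENNReal.ofReal_add (by linarith) (by linarith),
    ← ENNReal.ofReal_add (by linarith) (by linarith), ← ENNReal.ofReal_add (by linarith) (by linarith),
    ← ENNReal.ofReal_add (by linarith) (by linarith)]
  apply ENNReal.ofReal_le_ofReal
  have q1 := mul_le_mul_of_nonneg_left wU (show 0 ≤ 2 - s by linarith)
  have q2 := mul_le_mul_of_nonneg_left wV (show 0 ≤ 2 - s by linarith)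
  have q3 := mul_le_mul_of_nonneg_left wY (show 0 ≤ 2 * s - 2 by linarith)
  have q4 : (2 - s) * (s * (2 * c)) = (4 * s - 4) * c := by linear_combination (-2 * c) * hs2
  have q5 : s * c ≤ 1.415 * c := mul_le_mul_of_nonneg_right hs3 hc.le
  rw [q4] at q1 q2
  linarith

lemma path_insert {E : Type*} [PseudoMetricSpace E] (γ : ℝ → E) {a b c d : ℝ}
    (ha : a ∈ Icc (0 : ℝ) 1) (hc : c ∈ Icc (0 : ℝ) 1) (hd : d ∈ Icc (0 : ℝ) 1)
    (hab : a ≤ b) (hbc : b ≤ c) {M : ℝ}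
    (h1 : M ≤ dist (γ d) (γ a) + dist (γ a) (γ b) + dist (γ b) (γ c))
    (h2 : M ≤ dist (γ a) (γ d) + dist (γ d) (γ b) + dist (γ b) (γ c))
    (h3 : M ≤ dist (γ a) (γ b) + dist (γ b) (γ d) + dist (γ d) (γ c))
    (h4 : M ≤ dist (γ a) (γ b) + dist (γ b) (γ c) + dist (γ c) (γ d)) :
    ENNReal.ofReal M ≤ eVariationOn γ (Icc 0 1) := by
  rcases le_total d a with g1 | g1
  · exact path_le γ hd hc g1 hab hbc h1
  rcases le_total d b with g2 | g2
  · exact path_le γ ha hc g1 g2 hbc h2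
  rcases le_total d c with g3 | g3
  · exact path_le γ ha hc hab g2 g3 h3
  · exact path_le γ ha hd hab hbc g3 h4

lemma paths {E : Type*} [PseudoMetricSpace E] (γ : ℝ → E) {i j k l : ℝ}
    (hi : i ∈ Icc (0 : ℝ) 1) (hj : j ∈ Icc (0 : ℝ) 1) (hk : k ∈ Icc (0 : ℝ) 1)
    (hl : l ∈ Icc (0 : ℝ) 1) {M a b h D : ℝ}
    (d1 : dist (γ i) (γ j) = D) (d2 : dist (γ k) (γ l) = h)
    (d3 : dist (γ i) (γ k) = a) (d4 : dist (γ j) (γ k) = a)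
    (d5 : dist (γ i) (γ l) = b) (d6 : dist (γ j) (γ l) = b)
    (ha : a ≤ D) (hb : b ≤ D) (h1 : M ≤ h + a + b) (h2 : M ≤ a + 2 * b) (h3 : M ≤ b + 2 * a) :
    ENNReal.ofReal M ≤ eVariationOn γ (Icc 0 1) := by
  have e1 := dist_comm (γ i) (γ j)
  have e2 := dist_comm (γ k) (γ l)
  have e3 := dist_comm (γ i) (γ k)
  have e4 := dist_comm (γ j) (γ k)
  have e5 := dist_comm (γ i) (γ l)
  have e6 := dist_comm (γ j) (γ l)
  rcases le_total i j with g1 | g1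
  · rcases le_total k i with g2 | g2
    · apply path_insert γ hk hj hl g2 g1 <;> linarith
    rcases le_total k j with g3 | g3
    · apply path_insert γ hi hj hl g2 g3 <;> linarith
    · apply path_insert γ hi hk hl g1 g3 <;> linarith
  · rcases le_total k j with g2 | g2
    · apply path_insert γ hk hi hl g2 g1 <;> linarith
    rcases le_total k i with g3 | g3
    · apply path_insert γ hj hi hl g2 g3 <;> linarith
    · apply path_insert γ hj hk hl g1 g3 <;> linarith

lemma half_le {x : ENNReal} {M N : ℝ} (h : x ≤ ENNReal.ofReal N) (hM : N ≤ 2 * M) :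
    x / 2 ≤ ENNReal.ofReal M := by
  rw [ENNReal.div_le_iff (by norm_num) (by norm_num),
    show (2 : ENNReal) = ENNReal.ofReal 2 by simp, ← ENNReal.ofReal_mul' (by norm_num)]
  exact h.trans (ENNReal.ofReal_le_ofReal (by linarith))

lemma dist2 (p q : EuclideanSpace ℝ (Fin 2)) :
    dist p q ^ 2 = (p 0 - q 0) ^ 2 + (p 1 - q 1) ^ 2 := by
  rw [EuclideanSpace.dist_eq, Real.sq_sqrt (by positivity)]
  simp [Fin.sum_univ_two, Real.dist_eq, sq_abs]

lemma inner2 (n x : EuclideanSpace ℝ (Fin 2)) : inner ℝ n x = n 0 * x 0 + n 1 * x 1 := by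
  simp [PiLp.inner_apply, Fin.sum_univ_two]; ring

lemma core {K : Set (EuclideanSpace ℝ (Fin 2))}
    (hKc : IsCompact K) (hK : Convex ℝ K) (hint : (interior K).Nonempty)
    (c : ℝ) (hc : 0 < c) (hL : !₂[-c, 0] ∈ K) (hR : !₂[c, 0] ∈ K)
    (hD' : ∀ p ∈ K, ∀ q ∈ K, dist p q ≤ 2 * c) :
    ∃ p₁ p₂ p₃ p₄ : EuclideanSpace ℝ (Fin 2),
      p₁ ∈ frontier K ∧ p₂ ∈ frontier K ∧ p₃ ∈ frontier K ∧ p₄ ∈ frontier K ∧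
      ∀ γ : ℝ → EuclideanSpace ℝ (Fin 2),
        p₁ ∈ γ '' Icc 0 1 → p₂ ∈ γ '' Icc 0 1 → p₃ ∈ γ '' Icc 0 1 → p₄ ∈ γ '' Icc 0 1 →
        μH[1] (frontier K) / 2 ≤ eVariationOn γ (Icc 0 1) := by
  have hD : ∀ p ∈ K, ∀ q ∈ K, (p 0 - q 0) ^ 2 + (p 1 - q 1) ^ 2 ≤ (2 * c) ^ 2 := by
    intro p hp q hq
    rw [← dist2]
    exact pow_le_pow_left₀ dist_nonneg (hD' p hp q hq) 2
  have hX : ∀ p ∈ K, -c ≤ p 0 ∧ p 0 ≤ c := by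
    intro p hp
    have e1 := hD p hp _ hL
    have e2 := hD p hp _ hR
    simp at e1 e2
    constructor <;> nlinarith [sq_nonneg (p 1)]
  have hfr : ∀ p ∈ K, p ∉ interior K → p ∈ frontier K := fun p hp h => ⟨subset_closure hp, h⟩
  have hLf : !₂[-c, 0] ∈ frontier K := by
    refine hfr _ hL fun h => ?_
    obtain ⟨t, ht, h⟩ := interior_move h !₂[-1, 0]
    have := (hX _ h).1
    simp at this
    linarith
  have hRf : !₂[c, 0] ∈ frontier K := by
    refine hfr _ hR fun h => ?_
    obtain ⟨t, ht, h⟩ := interior_move h !₂[1, 0]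
    have := (hX _ h).2
    simp at this
    linarith
  -- the vertical chord
  have hO : (!₂[0, 0] : EuclideanSpace ℝ (Fin 2)) ∈ K := by
    have := hK hL hR (a := 1 / 2) (b := 1 / 2) (by norm_num) (by norm_num) (by norm_num)
    convert this using 1
    ext i
    fin_cases i <;> simp
  set Z : Set (EuclideanSpace ℝ (Fin 2)) := K ∩ {p | p 0 = 0} with hZ
  have hZc : IsCompact Z := hKc.inter_right (isClosed_eq (by fun_prop) continuous_const)
  have hZn : Z.Nonempty := ⟨_, hO, by simp⟩
  obtain ⟨T, ⟨hTK, hT0⟩, hTm⟩ := hZc.exists_isMaxOn hZn (f := fun p => p 1) (by fun_prop)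
  obtain ⟨B, ⟨hBK, hB0⟩, hBm⟩ := hZc.exists_isMinOn hZn (f := fun p => p 1) (by fun_prop)
  have hT0 : T 0 = 0 := hT0
  have hB0 : B 0 = 0 := hB0
  have hTm : ∀ p ∈ K, p 0 = 0 → p 1 ≤ T 1 := fun p h1 h2 => hTm ⟨h1, h2⟩
  have hBm : ∀ p ∈ K, p 0 = 0 → B 1 ≤ p 1 := fun p h1 h2 => hBm ⟨h1, h2⟩
  have hTi : T ∉ interior K := by
    intro h
    obtain ⟨t, ht, h⟩ := interior_move h !₂[0, 1]
    have := hTm _ h (by simp [hT0])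
    simp at this
    linarith
  have hBi : B ∉ interior K := by
    intro h
    obtain ⟨t, ht, h⟩ := interior_move h !₂[0, -1]
    have := hBm _ h (by simp [hB0])
    simp at this
    linarith
  have hτ : 0 ≤ T 1 := by simpa using hTm _ hO (by simp)
  have hβ : B 1 ≤ 0 := by simpa using hBm _ hO (by simp)
  have hpos : B 1 < T 1 := by
    obtain ⟨z, hz, hz0⟩ : ∃ z ∈ interior K, z 0 = 0 := by
      obtain ⟨q, hq⟩ := hint
      have hq' := hX q (interior_subset hq)
      rcases lt_or_ge (q 0) 0 with hlt | hge
      · have hd : 0 < c - q 0 := by linarith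
        refine ⟨(c / (c - q 0)) • q + (-q 0 / (c - q 0)) • !₂[c, 0], ?_, ?_⟩
        · apply hK.combo_interior_self_mem_interior hq hR (by positivity)
            (div_nonneg (by linarith) hd.le)
          field_simp; ring
        · simp; field_simp; ring
      · have hd : 0 < c + q 0 := by linarith
        refine ⟨(c / (c + q 0)) • q + (q 0 / (c + q 0)) • !₂[-c, 0], ?_, ?_⟩
        · apply hK.combo_interior_self_mem_interior hq hL (by positivity) (by positivity)
          field_simp
        · simp; field_simp; ring
    have e1 := hTm z (interior_subset hz) hz0
    have e2 := hBm z (interior_subset hz) hz0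
    by_contra hcon
    apply hTi
    have : T = z := by
      ext i
      fin_cases i
      · simp [hT0, hz0]
      · simp; linarith
    rwa [this]
  generalize hτe : T 1 = τ at *
  obtain ⟨β, hβe⟩ : ∃ β, B 1 = -β := ⟨-B 1, by ring⟩
  have hβ : 0 ≤ β := by linarith
  -- support lines
  obtain ⟨m₁, hm1, hm1'⟩ : ∃ m₁, |m₁| * c ≤ τ ∧ ∀ p ∈ K, p 1 ≤ τ + m₁ * p 0 := by
    obtain ⟨n, hn0, hn⟩ := exists_support hK hint (hfr T hTK hTi)
    simp only [inner2, PiLp.sub_apply, hT0, hτe] at hn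
    have e1 := hn _ hL
    have e2 := hn _ hR
    have e3 := hn _ hBK
    simp [hB0, hβe] at e1 e2 e3
    have e4 : 0 ≤ n 1 := by
      by_contra h
      push Not at h
      nlinarith
    have e5 : 0 < n 1 := by
      refine lt_of_le_of_ne e4 fun h => hn0 ?_
      rw [← h] at e1 e2
      ext i
      fin_cases i
      · simp; nlinarith
      · simp [← h]
    refine ⟨-(n 0) / n 1, ?_, ?_⟩
    · rw [abs_div, abs_neg, abs_of_pos e5, div_mul_eq_mul_div, div_le_iff₀ e5]
      rcases abs_cases (n 0) with h | h <;> rw [h.1] <;> nlinarith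
    · intro p hp
      have := hn p hp
      rw [div_mul_eq_mul_div, ← sub_le_iff_le_add', le_div_iff₀ e5]
      nlinarith
  obtain ⟨m₂, hm2, hm2'⟩ : ∃ m₂, |m₂| * c ≤ β ∧ ∀ p ∈ K, -β + m₂ * p 0 ≤ p 1 := by
    obtain ⟨n, hn0, hn⟩ := exists_support hK hint (hfr B hBK hBi)
    simp only [inner2, PiLp.sub_apply, hB0, hβe] at hn
    have e1 := hn _ hL
    have e2 := hn _ hR
    have e3 := hn _ hTK
    simp [hT0, hτe] at e1 e2 e3
    have e4 : n 1 ≤ 0 := by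
      by_contra h
      push Not at h
      nlinarith
    have e5 : 0 < -n 1 := by
      refine lt_of_le_of_ne (by linarith) fun h => hn0 ?_
      have h : n 1 = 0 := by linarith
      rw [h] at e1 e2
      ext i
      fin_cases i
      · simp; nlinarith
      · simp [h]
    refine ⟨n 0 / (-n 1), ?_, ?_⟩
    · rw [abs_div, abs_of_pos e5, div_mul_eq_mul_div, div_le_iff₀ e5]
      rcases abs_cases (n 0) with h | h <;> rw [h.1] <;> nlinarith
    · intro p hp
      have := hn p hp
      rw [div_mul_eq_mul_div, ← le_sub_iff_add_le', div_le_iff₀ e5]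
      nlinarith
  -- distances
  obtain ⟨L, hLe⟩ : ∃ L : EuclideanSpace ℝ (Fin 2), L = !₂[-c, 0] := ⟨_, rfl⟩
  obtain ⟨R, hRe⟩ : ∃ R : EuclideanSpace ℝ (Fin 2), R = !₂[c, 0] := ⟨_, rfl⟩
  rw [← hLe] at hL hLf
  rw [← hRe] at hR hRf
  have L0 : L 0 = -c := by simp [hLe]
  have L1 : L 1 = 0 := by simp [hLe]
  have R0 : R 0 = c := by simp [hRe]
  have R1 : R 1 = 0 := by simp [hRe]
  have dLR : dist L R = 2 * c := by
    apply (sq_eq_sq₀ dist_nonneg (by positivity)).1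
    rw [dist2, L0, L1, R0, R1]; ring
  have dTB : dist T B = τ + β := by
    apply (sq_eq_sq₀ dist_nonneg (by positivity)).1
    rw [dist2, hT0, hB0, hτe, hβe]; ring
  obtain ⟨a, hae⟩ : ∃ a, dist L T = a := ⟨_, rfl⟩
  obtain ⟨b, hbe⟩ : ∃ b, dist L B = b := ⟨_, rfl⟩
  have ha : 0 ≤ a := hae ▸ dist_nonneg
  have hb : 0 ≤ b := hbe ▸ dist_nonneg
  have ha2 : a ^ 2 = c ^ 2 + τ ^ 2 := by
    rw [← hae, dist2, L0, L1, hT0, hτe]; ring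
  have hb2 : b ^ 2 = c ^ 2 + β ^ 2 := by
    rw [← hbe, dist2, L0, L1, hB0, hβe]; ring
  have dRT : dist R T = a := by
    apply (sq_eq_sq₀ dist_nonneg ha).1
    rw [ha2, dist2, R0, R1, hT0, hτe]; ring
  have dRB : dist R B = b := by
    apply (sq_eq_sq₀ dist_nonneg hb).1
    rw [hb2, dist2, R0, R1, hB0, hβe]; ring
  have a2 : a ≤ 2 * c := hae ▸ hD' L hL T hTK
  have b2 : b ≤ 2 * c := hbe ▸ hD' L hL B hBK
  have bd1 := trap_bound hKc hK hint c τ β a b m₁ m₂ hc ha hb ha2 hb2 hm1 hm2 hX hm1' hm2'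
  have bd2 := oct_bound hKc hK hint c hc hX (hLe ▸ hL) (hRe ▸ hR) hD
  obtain ⟨M, hM⟩ : ∃ M, M = min (τ + β + a + b) (3.32 * c) := ⟨_, rfl⟩
  have hM1 : M ≤ τ + β + a + b := hM ▸ min_le_left _ _
  have hM2 : M ≤ 3.32 * c := hM ▸ min_le_right _ _
  have hM3 := real_ineq c τ β a b M hc hβ ha hb ha2 hb2 hM1 hM2
  have hM4 := real_ineq c β τ b a M hc hτ hb ha hb2 ha2 (by linarith) hM2
  have bd : μH[1] (frontier K) / 2 ≤ ENNReal.ofReal M := by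
    rcases min_choice (τ + β + a + b) (3.32 * c) with h | h
    · rw [hM, h]
      exact half_le bd1 (by linarith)
    · rw [hM, h]
      exact half_le bd2 (by linarith)
  refine ⟨L, R, T, B, hLf, hRf, hfr T hTK hTi, hfr B hBK hBi, ?_⟩
  rintro γ ⟨i, hi, hiL⟩ ⟨j, hj, hjR⟩ ⟨k, hk, hkT⟩ ⟨l, hl, hlB⟩
  refine bd.trans ?_
  exact paths γ hi hj hk hl (by rw [hiL, hjR, dLR]) (by rw [hkT, hlB, dTB])
    (by rw [hiL, hkT, hae]) (by rw [hjR, hkT, dRT]) (by rw [hiL, hlB, hbe]) (by rw [hjR, hlB, dRB])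
    a2 b2 (by linarith) hM3 hM4

lemma exists_isom (c : ℝ) (hc : 0 < c) (L R : EuclideanSpace ℝ (Fin 2)) (hce : dist L R = 2 * c) :
    ∃ (ρ : EuclideanSpace ℝ (Fin 2) ≃ₗᵢ[ℝ] EuclideanSpace ℝ (Fin 2)) (m : EuclideanSpace ℝ (Fin 2))
      (Φ : EuclideanSpace ℝ (Fin 2) ≃ᵢ EuclideanSpace ℝ (Fin 2)),
      (∀ x, Φ x = ρ x + m) ∧ Φ !₂[-c, 0] = L ∧ Φ !₂[c, 0] = R := by
  obtain ⟨w, hw⟩ : ∃ w : EuclideanSpace ℝ (Fin 2), w = (1 / 2 : ℝ) • (R - L) := ⟨_, rfl⟩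
  obtain ⟨e, he⟩ : ∃ e : EuclideanSpace ℝ (Fin 2), e = !₂[c, 0] := ⟨_, rfl⟩
  have hnorm : ‖e‖ = ‖w‖ := by
    rw [hw, norm_smul, ← dist_eq_norm, dist_comm, hce, he, EuclideanSpace.norm_eq]
    simp [Real.sqrt_sq hc.le]
  obtain ⟨ρ, hρ⟩ : ∃ ρ : EuclideanSpace ℝ (Fin 2) ≃ₗᵢ[ℝ] EuclideanSpace ℝ (Fin 2), ρ e = w :=
    ⟨_, Submodule.reflection_sub hnorm⟩
  have hΦ : ∀ x, (ρ.toIsometryEquiv.trans (IsometryEquiv.addRight ((1 / 2 : ℝ) • (L + R)))) x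
      = ρ x + (1 / 2 : ℝ) • (L + R) := fun x => rfl
  refine ⟨ρ, (1 / 2 : ℝ) • (L + R), _, hΦ, ?_, ?_⟩
  · have : (!₂[-c, 0] : EuclideanSpace ℝ (Fin 2)) = -e := by
      rw [he]; ext i; fin_cases i <;> simp
    rw [hΦ, this, map_neg, hρ, hw]; module
  · rw [hΦ, ← he, hρ, hw]; module

lemma exists_diam (K : Set (EuclideanSpace ℝ (Fin 2)))
    (hKc : IsCompact K) (hKint : (interior K).Nonempty) :
    ∃ (L R : EuclideanSpace ℝ (Fin 2)) (c : ℝ), L ∈ K ∧ R ∈ K ∧ (∀ p ∈ K, ∀ q ∈ K, dist p q ≤ dist L R) ∧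
      dist L R = 2 * c ∧ 0 < c := by
  have hne : K.Nonempty := hKint.mono interior_subset
  obtain ⟨w, hw, hwmax⟩ := (hKc.prod hKc).exists_isMaxOn (hne.prod hne)
    (continuous_dist.continuousOn)
  obtain ⟨L, hLw⟩ : ∃ L, L = w.1 := ⟨_, rfl⟩
  obtain ⟨R, hRw⟩ : ∃ R, R = w.2 := ⟨_, rfl⟩
  have hL : L ∈ K := hLw ▸ hw.1
  have hR : R ∈ K := hRw ▸ hw.2
  have hmax : ∀ p ∈ K, ∀ q ∈ K, dist p q ≤ dist L R := by
    intro p hp q hq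
    rw [hLw, hRw]
    exact isMaxOn_iff.1 hwmax (p, q) (mk_mem_prod hp hq)
  clear hwmax hLw hRw hw
  obtain ⟨c, hce⟩ : ∃ c, dist L R = 2 * c := ⟨dist L R / 2, by ring⟩
  have hc : 0 < c := by
    obtain ⟨z, hz⟩ := hKint
    obtain ⟨t, ht, h⟩ := interior_move hz !₂[1, 0]
    have h1 := hmax _ h _ (interior_subset hz)
    have h2 : 0 < dist (z + t • (!₂[1, 0] : EuclideanSpace ℝ (Fin 2))) z := by
      rw [dist_pos]
      intro h3
      have := congrArg (fun p : EuclideanSpace ℝ (Fin 2) => p 0) h3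
      simp only [PiLp.add_apply, PiLp.smul_apply, smul_eq_mul] at this
      rw [Matrix.cons_val_zero] at this
      linarith
    linarith
  exact ⟨L, R, c, hL, hR, hmax, hce, hc⟩

lemma preimage_conv (K : Set (EuclideanSpace ℝ (Fin 2))) (hKconv : Convex ℝ K)
    (ρ : EuclideanSpace ℝ (Fin 2) ≃ₗᵢ[ℝ] EuclideanSpace ℝ (Fin 2)) (m : EuclideanSpace ℝ (Fin 2))
    (Φ : EuclideanSpace ℝ (Fin 2) ≃ᵢ EuclideanSpace ℝ (Fin 2))
    (hΦ : ∀ x, Φ x = ρ x + m) : Convex ℝ (Φ ⁻¹' K) := by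
  intro x hx y hy s t hs ht hst
  have h := hKconv hx hy hs ht hst
  have e : Φ (s • x + t • y) = s • Φ x + t • Φ y := by
    rw [hΦ, hΦ, hΦ, map_add, map_smul, map_smul]
    have hm : m = s • m + t • m := by rw [← add_smul, hst, one_smul]
    nth_rewrite 1 [hm]
    module
  rw [mem_preimage, e]
  exact h

/-- For every planar compact convex body `K` there exist four points on `∂K` such that
every rectifiable curve passing through all four points has length at least
`(1/2) · per K`. -/
theorem stmt3 (K : Set (EuclideanSpace ℝ (Fin 2)))
    (hKc : IsCompact K) (hKconv : Convex ℝ K) (hKint : (interior K).Nonempty) :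
    ∃ p₁ p₂ p₃ p₄ : EuclideanSpace ℝ (Fin 2),
      p₁ ∈ frontier K ∧ p₂ ∈ frontier K ∧ p₃ ∈ frontier K ∧ p₄ ∈ frontier K ∧
      ∀ γ : ℝ → EuclideanSpace ℝ (Fin 2), ContinuousOn γ (Icc 0 1) →
        eVariationOn γ (Icc 0 1) ≠ ⊤ →
        p₁ ∈ γ '' Icc 0 1 → p₂ ∈ γ '' Icc 0 1 → p₃ ∈ γ '' Icc 0 1 → p₄ ∈ γ '' Icc 0 1 →
        μH[1] (frontier K) / 2 ≤ eVariationOn γ (Icc 0 1) := by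
  obtain ⟨L, R, c, hL, hR, hmax, hce, hc⟩ := exists_diam K hKc hKint
  obtain ⟨ρ, m, Φ, hΦ, hΦL, hΦR⟩ := exists_isom c hc L R hce
  have hfr : frontier (Φ ⁻¹' K) = Φ ⁻¹' frontier K := (Φ.toHomeomorph.preimage_frontier K).symm
  obtain ⟨p₁, p₂, p₃, p₄, h1, h2, h3, h4, hγ⟩ := core (K := Φ ⁻¹' K)
    (Φ.toHomeomorph.isCompact_preimage.2 hKc)
    (preimage_conv K hKconv ρ m Φ hΦ)
    (by
      have : Φ ⁻¹' interior K = interior (Φ ⁻¹' K) := Φ.toHomeomorph.preimage_interior K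
      rw [← this]
      exact hKint.preimage Φ.surjective)
    c hc (by rwa [mem_preimage, hΦL]) (by rwa [mem_preimage, hΦR])
    (by
      intro p hp q hq
      rw [← Φ.dist_eq, ← hce]
      exact hmax _ hp _ hq)
  rw [hfr] at h1 h2 h3 h4
  refine ⟨Φ p₁, Φ p₂, Φ p₃, Φ p₄, h1, h2, h3, h4, ?_⟩
  intro γ _ _ g1 g2 g3 g4
  have tr : ∀ p, Φ p ∈ γ '' Icc 0 1 → p ∈ (Φ.symm ∘ γ) '' Icc 0 1 := by
    rintro p ⟨t, ht, h⟩
    exact ⟨t, ht, by simp [h]⟩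
  have key := hγ (Φ.symm ∘ γ) (tr _ g1) (tr _ g2) (tr _ g3) (tr _ g4)
  rw [hfr, Φ.hausdorffMeasure_preimage] at key
  refine key.trans ?_
  have := (Φ.symm.isometry.lipschitz.lipschitzOnWith (s := univ)).comp_eVariationOn_le
    (g := γ) (s := Icc 0 1) (mapsTo_univ _ _)
  simpa using this
end

section
/- Let γ be a rectifiable curve in the plane whose convex hull contains a compact convex set K. Then the length of γ is at least half the perimeter of K. -/
open Set MeasureTheory


lemma absCos_sum (M : ℕ) (hM : 0 < M) (φ : ℝ) :
    ∑ k ∈ Finset.range M, |Real.cos (k * (Real.pi / M) + φ)| ≤ 1 / Real.sin (Real.pi / M / 2) := by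
  have hM' : (0:ℝ) < M := by exact_mod_cast hM
  have hM1 : (1:ℝ) ≤ M := by exact_mod_cast hM
  set δ := Real.pi / M with hδ
  have hMδ : M * δ = Real.pi := by rw [hδ]; field_simp
  have hδ0 : 0 < δ := by positivity
  have hδπ : δ ≤ Real.pi := by rw [← hMδ]; nlinarith
  have hs : 0 < Real.sin (δ / 2) := Real.sin_pos_of_pos_of_lt_pi (by linarith) (by linarith)
  have hper : Function.Periodic
      (fun φ : ℝ => ∑ k ∈ Finset.range M, |Real.cos (k * δ + φ)|) δ := by
    intro x
    have h1 := Finset.sum_range_succ (fun k : ℕ => |Real.cos (k * δ + x)|) M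
    have h2 := Finset.sum_range_succ' (fun k : ℕ => |Real.cos (k * δ + x)|) M
    have h3 : |Real.cos (M * δ + x)| = |Real.cos ((0:ℕ) * δ + x)| := by
      rw [hMδ, add_comm, Real.cos_add_pi, abs_neg]; simp
    have h4 : ∑ k ∈ Finset.range M, |Real.cos (k * δ + (x + δ))|
        = ∑ k ∈ Finset.range M, |Real.cos ((k+1 : ℕ) * δ + x)| := by
      refine Finset.sum_congr rfl fun k _ => ?_
      congr 2; push_cast; ring
    show ∑ k ∈ Finset.range M, |Real.cos (k * δ + (x + δ))| = _
    rw [h4]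
    linarith
  obtain ⟨ψ, hψ, hψe⟩ := hper.exists_mem_Ico hδ0 φ (-(Real.pi/2))
  change (∑ k ∈ Finset.range M, |Real.cos (k * δ + φ)|) = ∑ k ∈ Finset.range M, |Real.cos (k * δ + ψ)| at hψe
  rw [hψe]
  have key : ∀ n : ℕ, n ≤ M → 2 * Real.sin (δ/2) * ∑ k ∈ Finset.range n, |Real.cos (k * δ + ψ)|
      = Real.sin (n * δ + ψ - δ / 2) - Real.sin (ψ - δ/2) := by
    intro n
    induction n with
    | zero => intro _; simp
    | succ n ih =>
      intro hn
      rw [Finset.sum_range_succ, mul_add, ih (by omega)]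
      have hn' : ((n:ℝ) + 1) ≤ M := by exact_mod_cast hn
      have hp : 0 ≤ Real.cos (n * δ + ψ) := by
        apply Real.cos_nonneg_of_neg_pi_div_two_le_of_le
        · have := hψ.1
          have : 0 ≤ n * δ := by positivity
          linarith
        · have := hψ.2
          have : (n + 1) * δ ≤ M * δ := by gcongr
          nlinarith
      rw [abs_of_nonneg hp]
      have e1 : ((n+1 : ℕ):ℝ) * δ + ψ - δ / 2 = (n * δ + ψ) + δ/2 := by push_cast; ring
      have e2 : (n:ℝ) * δ + ψ - δ / 2 = (n * δ + ψ) - δ/2 := by ring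
      rw [e1, e2, Real.sin_add, Real.sin_sub]
      ring
  have h := key M le_rfl
  rw [le_div_iff₀ hs]
  have h5 : Real.sin (M * δ + ψ - δ / 2) = - Real.sin (ψ - δ/2) := by
    rw [hMδ, ← Real.sin_add_pi]; congr 1; ring
  rw [h5] at h
  have := Real.neg_one_le_sin (ψ - δ/2)
  nlinarith

/-- inner product with the unit vector of angle φ -/
noncomputable def ipv (φ : ℝ) (x : EuclideanSpace ℝ (Fin 2)) : ℝ := Real.cos φ * x 0 + Real.sin φ * x 1

lemma ipv_sub (φ : ℝ) (x y : (EuclideanSpace ℝ (Fin 2))) : ipv φ (x - y) = ipv φ x - ipv φ y := by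
  simp [ipv]; ring

lemma ipv_pi (φ : ℝ) (x : (EuclideanSpace ℝ (Fin 2))) : ipv (φ + Real.pi) x = - ipv φ x := by
  simp [ipv]; ring

lemma abs_ipv_sum (M : ℕ) (hM : 0 < M) (v : (EuclideanSpace ℝ (Fin 2))) :
    ∑ k ∈ Finset.range M, |ipv (k * (Real.pi / M)) v| ≤ 1 / Real.sin (Real.pi / M / 2) * ‖v‖ := by
  set z : ℂ := ⟨v 0, v 1⟩ with hz
  have hn : ‖z‖ = ‖v‖ := by
    rw [EuclideanSpace.norm_eq, Complex.norm_eq_sqrt_sq_add_sq]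
    simp [hz, Fin.sum_univ_two]
  have h0 : v 0 = ‖v‖ * Real.cos z.arg := by rw [← hn, Complex.norm_mul_cos_arg]
  have h1 : v 1 = ‖v‖ * Real.sin z.arg := by rw [← hn, Complex.norm_mul_sin_arg]
  have : ∀ k ∈ Finset.range M, |ipv (k * (Real.pi / M)) v|
      = |Real.cos (k * (Real.pi / M) + (- z.arg))| * ‖v‖ := by
    intro k _
    rw [← abs_of_nonneg (norm_nonneg v), ← abs_mul]
    congr 1
    rw [ipv, Real.cos_add, Real.cos_neg, Real.sin_neg]
    nth_rewrite 1 [h0]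
    nth_rewrite 1 [h1]
    ring
  rw [Finset.sum_congr rfl this, ← Finset.sum_mul]
  gcongr
  exact absCos_sum M hM _

/-- finitely many points of [0,1] lie on a monotone sequence -/
lemma exists_seq (T : Finset ℝ) (hT : T.Nonempty) (hT1 : ∀ t ∈ T, t ∈ Icc (0:ℝ) 1) :
    ∃ (n : ℕ) (f : ℕ → ℝ), Monotone f ∧ (∀ i, f i ∈ Icc (0:ℝ) 1) ∧
      ∀ t ∈ T, ∃ i, i ≤ n ∧ f i = t := by
  have hc : 0 < T.card := hT.card_pos
  let e := T.orderEmbOfFin rfl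
  refine ⟨T.card, fun i => e ⟨min i (T.card - 1), by omega⟩, ?_, ?_, ?_⟩
  · intro i j hij
    apply e.monotone
    simp only [Fin.mk_le_mk]
    omega
  · intro i
    exact hT1 _ (Finset.orderEmbOfFin_mem _ _ _)
  · intro t ht
    have : t ∈ Set.range e := by simp only [e, Finset.range_orderEmbOfFin]; exact ht
    obtain ⟨i, hi⟩ := this
    refine ⟨i, i.2.le, ?_⟩
    rw [← hi]
    have h2 := i.2
    have h3 : min (i:ℕ) (T.card - 1) = i := by omega
    simp only [h3]

lemma abs_sub_le_sum (g : ℕ → ℝ) (n i j : ℕ) (hi : i ≤ n) (hj : j ≤ n) :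
    |g i - g j| ≤ ∑ l ∈ Finset.range n, |g (l+1) - g l| := by
  wlog hij : i ≤ j generalizing i j
  · rw [abs_sub_comm]; exact this j i hj hi (by omega)
  have h := dist_le_Ico_sum_dist g hij
  rw [Real.dist_eq] at h
  refine h.trans ?_
  have : ∀ l ∈ Finset.Ico i j, dist (g l) (g (l+1)) = |g (l+1) - g l| := by
    intro l _; rw [dist_comm, Real.dist_eq]
  rw [Finset.sum_congr rfl this]
  apply Finset.sum_le_sum_of_subset_of_nonneg
  · intro l; simp; omega
  · intros; positivity

lemma width_sum (γ : ℝ → (EuclideanSpace ℝ (Fin 2))) (hγrect : eVariationOn γ (Icc 0 1) ≠ ⊤)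
    (M : ℕ) (hM : 0 < M) (s t : ℕ → ℝ) (hs : ∀ k, s k ∈ Icc (0:ℝ) 1) (ht : ∀ k, t k ∈ Icc (0:ℝ) 1) :
    ∑ k ∈ Finset.range M, (ipv (k * (Real.pi / M)) (γ (s k)) - ipv (k * (Real.pi / M)) (γ (t k)))
      ≤ 1 / Real.sin (Real.pi / M / 2) * (eVariationOn γ (Icc 0 1)).toReal := by
  classical
  have hpos : 0 ≤ 1 / Real.sin (Real.pi / M / 2) :=
    le_trans (Finset.sum_nonneg fun _ _ => abs_nonneg _) (absCos_sum M hM 0)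
  let T : Finset ℝ := (Finset.range M).image s ∪ (Finset.range M).image t
  obtain ⟨n, f, hf, hf1, hfT⟩ := exists_seq T
    ⟨s 0, Finset.mem_union_left _ (Finset.mem_image_of_mem _ (by simpa using hM))⟩ (by
      intro x hx
      simp only [T, Finset.mem_union, Finset.mem_image] at hx
      rcases hx with ⟨k, _, rfl⟩ | ⟨k, _, rfl⟩
      · exact hs k
      · exact ht k)
  have h1 : ∀ k ∈ Finset.range M,
      (ipv (k * (Real.pi / M)) (γ (s k)) - ipv (k * (Real.pi / M)) (γ (t k)))
      ≤ ∑ l ∈ Finset.range n, |ipv (k * (Real.pi / M)) (γ (f (l+1)) - γ (f l))| := by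
    intro k hk
    obtain ⟨i, hi, his⟩ := hfT (s k) (Finset.mem_union_left _ (Finset.mem_image_of_mem _ hk))
    obtain ⟨j, hj, hjs⟩ := hfT (t k) (Finset.mem_union_right _ (Finset.mem_image_of_mem _ hk))
    rw [← his, ← hjs]
    refine (le_abs_self _).trans ?_
    simp only [ipv_sub]
    exact abs_sub_le_sum (fun l => ipv (k * (Real.pi / M)) (γ (f l))) n i j hi hj
  refine (Finset.sum_le_sum h1).trans ?_
  rw [Finset.sum_comm]
  refine (Finset.sum_le_sum fun l _ => abs_ipv_sum M hM (γ (f (l+1)) - γ (f l))).trans ?_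
  rw [← Finset.mul_sum]
  gcongr
  have h2 := eVariationOn.sum_le (f := γ) (s := Icc 0 1) (n := n) hf hf1
  rw [← ENNReal.ofReal_le_iff_le_toReal hγrect]
  rw [ENNReal.ofReal_sum_of_nonneg (fun _ _ => norm_nonneg _)]
  refine le_trans (le_of_eq ?_) h2
  refine Finset.sum_congr rfl fun l _ => ?_
  rw [edist_dist, dist_eq_norm]

lemma hausdorff_le_of_proj (F K S : Set (EuclideanSpace ℝ (Fin 2))) (hFK : F ⊆ K)
    (h : ∀ x ∈ F, ∃ y ∈ S, ∀ w ∈ K, inner ℝ (y - x) (w - x) ≤ 0) :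
    μH[1] F ≤ μH[1] S := by
  choose! y hyS hy using h
  have hanti : AntilipschitzWith 1 (fun x : F => y x) := by
    apply AntilipschitzWith.of_le_mul_dist
    intro a b
    have h1 := hy a a.2 b (hFK b.2)
    have h2 := hy b b.2 a (hFK a.2)
    simp only [NNReal.coe_one, one_mul]
    rw [Subtype.dist_eq, dist_eq_norm, dist_eq_norm]
    obtain ⟨p, hp⟩ := a
    obtain ⟨q, hq⟩ := b
    simp only at h1 h2 ⊢
    have h3 : ‖p - q‖ ^ 2 ≤ inner ℝ (y p - y q) (p - q) := by
      have e : inner ℝ (y p - y q) (p - q) = ‖p - q‖^2 - inner ℝ (y p - p) (q - p)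
          - inner ℝ (y q - q) (p - q) := by
        rw [← real_inner_self_eq_norm_sq, ← neg_sub p q, inner_neg_right, sub_neg_eq_add,
          ← inner_add_left, ← inner_sub_left]
        congr 1; abel
      linarith
    have h4 := real_inner_le_norm (y p - y q) (p - q)
    by_cases h0 : ‖p - q‖ = 0
    · rw [h0]; positivity
    · have : 0 < ‖p - q‖ := lt_of_le_of_ne (norm_nonneg _) (Ne.symm h0)
      nlinarith
  have e1 : μH[1] F = μH[1] (univ : Set F) := by
    have := (isometry_subtype_coe (s := F)).hausdorffMeasure_image (d := 1) (Or.inl (by norm_num)) univ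
    rw [← this]; simp
  rw [e1]
  have := hanti.le_hausdorffMeasure_image (d := 1) (by norm_num) univ
  simp only [ENNReal.coe_one, ENNReal.one_rpow, one_mul] at this
  refine this.trans (measure_mono ?_)
  rintro _ ⟨x, _, rfl⟩
  exact hyS x x.2

lemma exists_normal (K : Set (EuclideanSpace ℝ (Fin 2))) (hKconv : Convex ℝ K) (hKint : (interior K).Nonempty)
    (x : (EuclideanSpace ℝ (Fin 2))) (hx : x ∈ frontier K) : ∃ v : (EuclideanSpace ℝ (Fin 2)), v ≠ 0 ∧ ∀ w ∈ K, inner ℝ v (w - x) ≤ 0 := by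
  obtain ⟨f, hf⟩ := geometric_hahn_banach_open_point hKconv.interior isOpen_interior
    (show x ∉ interior K from hx.2)
  have hfK : ∀ w ∈ K, f w ≤ f x := by
    have : K ⊆ closure (interior K) := by
      rw [hKconv.closure_interior_eq_closure_of_nonempty_interior hKint]; exact subset_closure
    intro w hw
    have hc : IsClosed {w | f w ≤ f x} := isClosed_le f.continuous continuous_const
    exact closure_minimal (fun a ha => (hf a ha).le) hc (this hw)
  refine ⟨(InnerProductSpace.toDual ℝ (EuclideanSpace ℝ (Fin 2))).symm f, ?_, ?_⟩
  · intro h0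
    obtain ⟨a, ha⟩ := hKint
    have h1 := hf a ha
    rw [← InnerProductSpace.toDual_symm_apply, ← InnerProductSpace.toDual_symm_apply, h0] at h1
    simp at h1
  · intro w hw
    rw [InnerProductSpace.toDual_symm_apply, map_sub]
    linarith [hfK w hw]

/-- point on the line with normal angle φ, height h, parameter t -/
noncomputable def linePt (φ h t : ℝ) : EuclideanSpace ℝ (Fin 2) :=
  !₂[h * Real.cos φ - t * Real.sin φ, h * Real.sin φ + t * Real.cos φ]

lemma linePt_isometry (φ h : ℝ) : Isometry (linePt φ h) := by
  apply Isometry.of_dist_eq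
  intro s t
  rw [EuclideanSpace.dist_eq, Real.dist_eq, ← Real.sqrt_sq_eq_abs]
  congr 1
  simp only [linePt, Fin.sum_univ_two, Real.dist_eq, sq_abs]
  simp
  nlinarith [Real.sin_sq_add_cos_sq φ]

lemma measure_seg (φ h a b : ℝ) : μH[1] (linePt φ h '' Icc a b) = ENNReal.ofReal (b - a) := by
  rw [(linePt_isometry φ h).hausdorffMeasure_image (Or.inl (by norm_num)), hausdorffMeasure_real,
    Real.volume_Icc]

/-- coordinate along tangent -/
lemma mem_seg (φ δ : ℝ) (hδ : 0 < Real.sin δ) (h hp hm : ℝ) (y : (EuclideanSpace ℝ (Fin 2))) (h0 : ipv φ y = h)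
    (h1 : ipv (φ + δ) y ≤ hp) (h2 : ipv (φ - δ) y ≤ hm) :
    (ipv (φ + Real.pi / 2) y ∈ Icc (-((hm - h * Real.cos δ) / Real.sin δ))
      ((hp - h * Real.cos δ) / Real.sin δ)) ∧ linePt φ h (ipv (φ + Real.pi/2) y) = y := by
  subst h0
  simp only [ipv, Real.cos_add, Real.sin_add, Real.cos_sub, Real.sin_sub] at *
  simp only [Real.cos_pi_div_two, Real.sin_pi_div_two]
  have hq := Real.sin_sq_add_cos_sq φ
  refine ⟨⟨?_, ?_⟩, ?_⟩
  · rw [← neg_div, div_le_iff₀ hδ]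
    nlinarith
  · rw [le_div_iff₀ hδ]
    nlinarith
  · ext i
    fin_cases i
    · simp [linePt]; linear_combination (y 0) * hq
    · simp [linePt]; linear_combination (y 1) * hq

lemma ipv_per (φ : ℝ) (n : ℤ) (x : (EuclideanSpace ℝ (Fin 2))) : ipv (φ + n * (2 * Real.pi)) x = ipv φ x := by
  simp [ipv]

lemma ipv_add_smul (φ τ : ℝ) (x v : (EuclideanSpace ℝ (Fin 2))) : ipv φ (x + τ • v) = ipv φ x + τ * ipv φ v := by
  simp [ipv]; ring

/-- A ray from a point of the polygon hits one of its sides. -/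
lemma ray_hits (M : ℕ) (hM : 2 ≤ M) (h : ℕ → ℝ) (x v : (EuclideanSpace ℝ (Fin 2))) (hv : v ≠ 0)
    (hx : ∀ k < 2 * M, ipv (k * (Real.pi / M)) x ≤ h k) :
    ∃ τ : ℝ, 0 ≤ τ ∧ (∀ k < 2 * M, ipv (k * (Real.pi / M)) (x + τ • v) ≤ h k) ∧
      ∃ k < 2 * M, ipv (k * (Real.pi / M)) (x + τ • v) = h k := by
  have hM' : (2:ℝ) ≤ M := by exact_mod_cast hM
  have hMδ : M * (Real.pi / M) = Real.pi := by field_simp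
  set δ := Real.pi / M with hδ
  have hδ0 : 0 < δ := by positivity
  have hδπ : δ < Real.pi := by nlinarith
  have hs : 0 < Real.sin δ := Real.sin_pos_of_pos_of_lt_pi hδ0 hδπ
  let A := (Finset.range (2 * M)).filter fun k : ℕ => 0 < ipv (k * δ) v
  have hA : A.Nonempty := by
    by_contra hne
    rw [Finset.not_nonempty_iff_eq_empty] at hne
    have hle : ∀ k < 2 * M, ipv (k * δ) v ≤ 0 := by
      intro k hk
      by_contra hc
      have : k ∈ A := Finset.mem_filter.2 ⟨Finset.mem_range.2 hk, not_le.1 hc⟩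
      rw [hne] at this
      simp at this
    have heq : ∀ k < M, ipv (k * δ) v = 0 := by
      intro k hk
      have h1 := hle k (by omega)
      have h2 := hle (k + M) (by omega)
      have : ((k + M : ℕ) : ℝ) * δ = k * δ + Real.pi := by push_cast; rw [add_mul, hMδ]
      rw [this, ipv_pi] at h2
      linarith
    have h0 := heq 0 (by omega)
    have h1 := heq 1 (by omega)
    simp [ipv] at h0 h1
    rw [h0] at h1
    simp [hs.ne'] at h1
    apply hv
    ext i
    fin_cases i
    · simpa using h0
    · simpa using h1
  obtain ⟨k0, hk0, hmin⟩ := Finset.exists_min_image A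
    (fun k : ℕ => (h k - ipv (k * δ) x) / ipv (k * δ) v) hA
  have hk0' := Finset.mem_filter.1 hk0
  have hk0r := Finset.mem_range.1 hk0'.1
  have hτ : 0 ≤ (h k0 - ipv (k0 * δ) x) / ipv (k0 * δ) v :=
    div_nonneg (by linarith [hx k0 hk0r]) hk0'.2.le
  refine ⟨_, hτ, ?_, k0, hk0r, ?_⟩
  · intro k hk
    rw [ipv_add_smul]
    by_cases hc : 0 < ipv (k * δ) v
    · have h1 := hmin k (Finset.mem_filter.2 ⟨Finset.mem_range.2 hk, hc⟩)
      rw [le_div_iff₀ hc] at h1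
      linarith
    · have := mul_nonneg hτ (neg_nonneg.2 (not_lt.1 hc))
      linarith [hx k hk]
  · rw [ipv_add_smul, div_mul_cancel₀ _ hk0'.2.ne']
    ring

lemma main_bound (K : Set (EuclideanSpace ℝ (Fin 2)))
    (hKc : IsCompact K) (hKconv : Convex ℝ K) (hKint : (interior K).Nonempty)
    (γ : ℝ → EuclideanSpace ℝ (Fin 2)) (hγc : ContinuousOn γ (Icc 0 1))
    (hγrect : eVariationOn γ (Icc 0 1) ≠ ⊤)
    (hcover : K ⊆ convexHull ℝ (γ '' Icc 0 1)) (M : ℕ) (hM : 2 ≤ M) :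
    μH[1] (frontier K) ≤
      ENNReal.ofReal (2 * (eVariationOn γ (Icc 0 1)).toReal / Real.cos (Real.pi / M / 2)) := by
  have hM' : (2:ℝ) ≤ M := by exact_mod_cast hM
  have hMδ : M * (Real.pi / M) = Real.pi := by field_simp
  have hW := width_sum γ hγrect M (by omega)
  set δ := Real.pi / M with hδ
  have hδ0 : 0 < δ := by positivity
  have hδπ : δ < Real.pi := by nlinarith
  have hs : 0 < Real.sin δ := Real.sin_pos_of_pos_of_lt_pi hδ0 hδπ
  have hs2 : 0 < Real.sin (δ/2) :=
    Real.sin_pos_of_pos_of_lt_pi (by linarith) (by linarith)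
  have hc2 : 0 < Real.cos (δ/2) :=
    Real.cos_pos_of_mem_Ioo ⟨by linarith, by linarith⟩
  have hmax : ∀ φ : ℝ, ∃ t ∈ Icc (0:ℝ) 1, ∀ s ∈ Icc (0:ℝ) 1, ipv φ (γ s) ≤ ipv φ (γ t) := by
    intro φ
    have hcont : Continuous (ipv φ) := by unfold ipv; fun_prop
    obtain ⟨t, ht, hm⟩ := isCompact_Icc.exists_isMaxOn (nonempty_Icc.2 zero_le_one)
      (hcont.comp_continuousOn hγc)
    exact ⟨t, ht, fun s hs => hm hs⟩
  choose t ht htmax using hmax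
  let h : ℝ → ℝ := fun φ => ipv φ (γ (t φ))
  have hper : ∀ (φ : ℝ) (n : ℤ), h (φ + n * (2 * Real.pi)) = h φ := by
    intro φ n
    apply le_antisymm
    · simp only [h]
      rw [ipv_per]
      exact htmax _ _ (ht _)
    · have := htmax (φ + n * (2 * Real.pi)) (t φ) (ht _)
      rw [ipv_per] at this
      exact this
  have hKh : ∀ φ, ∀ x ∈ K, ipv φ x ≤ h φ := by
    intro φ x hx
    have hcv : Convex ℝ {x : (EuclideanSpace ℝ (Fin 2)) | ipv φ x ≤ h φ} := by
      intro a ha b hb p q hp hq hpq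
      simp only [mem_ofPred_eq] at *
      have e : ipv φ (p • a + q • b) = p * ipv φ a + q * ipv φ b := by simp [ipv]; ring
      have e2 : h φ = p * h φ + q * h φ := by rw [← add_mul, hpq, one_mul]
      rw [e, e2]
      gcongr
    exact convexHull_min (by rintro _ ⟨s, hs, rfl⟩; exact htmax φ s hs) hcv (hcover hx)
  let a : ℕ → ℝ := fun k => -((h (k * δ - δ) - h (k * δ) * Real.cos δ) / Real.sin δ)
  let b : ℕ → ℝ := fun k => (h (k * δ + δ) - h (k * δ) * Real.cos δ) / Real.sin δ
  let S : Set (EuclideanSpace ℝ (Fin 2)) := ⋃ k ∈ Finset.range (2 * M), linePt (k * δ) (h (k * δ)) '' Icc (a k) (b k)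
  have hFK : frontier K ⊆ K := hKc.isClosed.frontier_subset
  have hFS : μH[1] (frontier K) ≤ μH[1] S := by
    apply hausdorff_le_of_proj _ K S hFK
    intro x hx
    obtain ⟨v, hv, hvK⟩ := exists_normal K hKconv hKint x hx
    obtain ⟨τ, hτ, hP, k, hk, hke⟩ := ray_hits M hM (fun k => h (k * δ)) x v hv
      (fun k _ => hKh _ x (hFK hx))
    refine ⟨x + τ • v, ?_, ?_⟩
    · have hall : ∀ m : ℤ, ipv (m * δ) (x + τ • v) ≤ h (m * δ) := by
        intro m
        have hpos : (0:ℤ) < 2 * M := by omega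
        have h1 := Int.emod_nonneg m hpos.ne'
        have h2 := Int.emod_lt_of_pos m hpos
        obtain ⟨r, hr⟩ := Int.eq_ofNat_of_zero_le h1
        have h3 := Int.mul_ediv_add_emod m (2 * M)
        have h4 : (m:ℝ) * δ = r * δ + (m / (2 * M) : ℤ) * (2 * Real.pi) := by
          rw [hr] at h3
          have : (m:ℝ) = 2 * M * (m / (2 * M) : ℤ) + r := by exact_mod_cast h3.symm
          rw [← hMδ]
          nth_rewrite 1 [this]
          ring
        rw [h4, ipv_per, hper]
        exact hP r (by omega)
      have h1 := hall (k + 1)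
      have h2 := hall (k - 1)
      have e1 : ((k + 1 : ℤ) : ℝ) * δ = k * δ + δ := by push_cast; ring
      have e2 : ((k - 1 : ℤ) : ℝ) * δ = k * δ - δ := by push_cast; ring
      rw [e1] at h1
      rw [e2] at h2
      have := mem_seg (k * δ) δ hs (h (k * δ)) _ _ _ hke h1 h2
      simp only [S, mem_iUnion]
      exact ⟨k, Finset.mem_range.2 hk, _, this.1, this.2⟩
    · intro w hw
      rw [add_sub_cancel_left, inner_smul_left]
      simp only [conj_trivial]
      exact mul_nonpos_of_nonneg_of_nonpos hτ (hvK w hw)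
  have hab : ∀ k, 0 ≤ b k - a k := by
    intro k
    have := (mem_seg (k * δ) δ hs (h (k * δ)) (h (k * δ + δ)) (h (k * δ - δ)) (γ (t (k * δ))) rfl
      (htmax _ _ (ht _)) (htmax _ _ (ht _))).1
    linarith [this.1, this.2]
  have hS : μH[1] S ≤ ENNReal.ofReal (∑ k ∈ Finset.range (2 * M), (b k - a k)) := by
    rw [ENNReal.ofReal_sum_of_nonneg (fun k _ => hab k)]
    refine (measure_biUnion_finset_le _ _).trans ?_
    simp only [measure_seg]
    exact le_rfl
  refine (hFS.trans hS).trans (ENNReal.ofReal_le_ofReal ?_)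
  -- sums
  set H := ∑ k ∈ Finset.range (2 * M), h (k * δ) with hH
  have hp1 : ∑ k ∈ Finset.range (2 * M), h (k * δ + δ) = H := by
    have h1 := Finset.sum_range_succ (fun k : ℕ => h (k * δ)) (2 * M)
    have h2 := Finset.sum_range_succ' (fun k : ℕ => h (k * δ)) (2 * M)
    have h3 : h ((2 * M : ℕ) * δ) = h ((0 : ℕ) * δ) := by
      rw [← hper ((0:ℕ) * δ) 1]; congr 1; rw [← hMδ]; push_cast; ring
    have h4 : ∑ k ∈ Finset.range (2 * M), h (k * δ + δ)
        = ∑ k ∈ Finset.range (2 * M), h ((k + 1 : ℕ) * δ) :=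
      Finset.sum_congr rfl fun k _ => by congr 1; push_cast; ring
    rw [h4]; linarith
  have hm1 : ∑ k ∈ Finset.range (2 * M), h (k * δ - δ) = H := by
    have h1 := Finset.sum_range_succ (fun k : ℕ => h (k * δ - δ)) (2 * M)
    have h2 := Finset.sum_range_succ' (fun k : ℕ => h (k * δ - δ)) (2 * M)
    have h3 : h ((2 * M : ℕ) * δ - δ) = h ((0 : ℕ) * δ - δ) := by
      rw [← hper ((0:ℕ) * δ - δ) 1]; congr 1; rw [← hMδ]; push_cast; ring
    have h4 : H = ∑ k ∈ Finset.range (2 * M), h ((k + 1 : ℕ) * δ - δ) :=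
      Finset.sum_congr rfl fun k _ => by congr 1; push_cast; ring
    rw [h4]; linarith
  have hsum : ∑ k ∈ Finset.range (2 * M), (b k - a k)
      = 2 * (1 - Real.cos δ) / Real.sin δ * H := by
    have : ∀ k ∈ Finset.range (2 * M), b k - a k =
        (h (k * δ + δ) + h (k * δ - δ)) / Real.sin δ
          - h (k * δ) * (2 * Real.cos δ / Real.sin δ) := by
      intro k _; simp only [a, b]; ring
    rw [Finset.sum_congr rfl this, Finset.sum_sub_distrib, ← Finset.sum_div,
      Finset.sum_add_distrib, hp1, hm1, ← Finset.sum_mul, ← hH]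
    ring
  have hHW : H ≤ 1 / Real.sin (δ / 2) * (eVariationOn γ (Icc 0 1)).toReal := by
    refine le_trans (le_of_eq ?_) (hW (fun k => t (k * δ)) (fun k => t (k * δ + Real.pi))
      (fun _ => ht _) (fun _ => ht _))
    rw [hH, two_mul, Finset.sum_range_add, ← Finset.sum_add_distrib]
    refine Finset.sum_congr rfl fun k _ => ?_
    have : ((M + k : ℕ) : ℝ) * δ = k * δ + Real.pi := by rw [← hMδ]; push_cast; ring
    rw [this]
    simp only [h, ipv_pi]
    ring
  have htan : 2 * (1 - Real.cos δ) / Real.sin δ = 2 * Real.sin (δ/2) / Real.cos (δ/2) := by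
    have e1 : Real.cos δ = 1 - 2 * Real.sin (δ/2)^2 := by
      have := Real.cos_two_mul (δ/2)
      have h2 := Real.sin_sq_add_cos_sq (δ/2)
      rw [show 2 * (δ/2) = δ by ring] at this
      linarith
    have e2 : Real.sin δ = 2 * Real.sin (δ/2) * Real.cos (δ/2) := by
      rw [← Real.sin_two_mul]; congr 1; ring
    rw [e1, e2]
    field_simp
    ring
  rw [hsum, htan]
  calc 2 * Real.sin (δ/2) / Real.cos (δ/2) * H
      ≤ 2 * Real.sin (δ/2) / Real.cos (δ/2) *
        (1 / Real.sin (δ / 2) * (eVariationOn γ (Icc 0 1)).toReal) := by gcongr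
    _ = _ := by field_simp

/-- If the convex hull of a rectifiable curve `γ` contains a planar compact convex
body `K`, then the length of `γ` is at least half the perimeter of `K`. -/
theorem stmt5 (K : Set (EuclideanSpace ℝ (Fin 2)))
    (hKc : IsCompact K) (hKconv : Convex ℝ K) (hKint : (interior K).Nonempty)
    (γ : ℝ → EuclideanSpace ℝ (Fin 2)) (hγc : ContinuousOn γ (Icc 0 1))
    (hγrect : eVariationOn γ (Icc 0 1) ≠ ⊤)
    (hcover : K ⊆ convexHull ℝ (γ '' Icc 0 1)) :
    μH[1] (frontier K) / 2 ≤ eVariationOn γ (Icc 0 1) := by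
  have hlim : Filter.Tendsto (fun M : ℕ =>
      ENNReal.ofReal (2 * (eVariationOn γ (Icc 0 1)).toReal / Real.cos (Real.pi / M / 2)))
      Filter.atTop (nhds (ENNReal.ofReal (2 * (eVariationOn γ (Icc 0 1)).toReal / 1))) := by
    apply ENNReal.tendsto_ofReal
    refine Filter.Tendsto.div tendsto_const_nhds ?_ one_ne_zero
    have h1 : Filter.Tendsto (fun M : ℕ => Real.pi / M / 2) Filter.atTop (nhds 0) := by
      have := (tendsto_const_div_atTop_nhds_zero_nat Real.pi).div_const 2
      simpa using this
    have h2 := (Real.continuous_cos.tendsto 0).comp h1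
    rw [Real.cos_zero] at h2
    exact h2
  have hle := ge_of_tendsto hlim (Filter.eventually_atTop.2
    ⟨2, fun M hM => main_bound K hKc hKconv hKint γ hγc hγrect hcover M hM⟩)
  rw [div_one, ENNReal.ofReal_mul (by norm_num), ENNReal.ofReal_toReal hγrect] at hle
  apply ENNReal.div_le_of_le_mul
  rw [mul_comm]
  simpa using hle
end

section
/- Let K be a compact convex set in the plane with nonempty interior, and let γ be a rectifiable curve passing through all extreme points of K. Then the length of γ is at least (perimeter of K) minus (diameter of K). -/
open Set MeasureTheory Metric

namespace PerDiam

abbrev E := EuclideanSpace ℝ (Fin 2)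

/-- unit vector at angle `θ` -/
noncomputable def U (θ : ℝ) : E := !₂[Real.cos θ, Real.sin θ]

lemma inner_U (θ : ℝ) (z : E) :
    inner ℝ (U θ) z = Real.cos θ * z 0 + Real.sin θ * z 1 := by
  simp [U, PiLp.inner_apply, Fin.sum_univ_two, mul_comm]

/-- one-dimensional measure bound through an expanding map to an interval -/
lemma measure_le_of_expand (A : Set E) (σ : E → ℝ) (a b : ℝ)
    (h1 : ∀ x ∈ A, ∀ y ∈ A, dist x y ≤ |σ x - σ y|) (h2 : ∀ x ∈ A, σ x ∈ Icc a b) :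
    μH[1] A ≤ ENNReal.ofReal (b - a) := by
  have hinj : InjOn σ A := by
    intro x hx y hy hxy
    have := h1 x hx y hy
    rw [hxy, sub_self, abs_zero] at this
    exact dist_le_zero.1 this
  have hL : LipschitzOnWith 1 (Function.invFunOn σ A) (σ '' A) := by
    apply LipschitzOnWith.of_dist_le_mul
    rintro _ ⟨x, hx, rfl⟩ _ ⟨y, hy, rfl⟩
    rw [hinj.leftInvOn_invFunOn hx, hinj.leftInvOn_invFunOn hy]
    simpa [Real.dist_eq] using h1 x hx y hy
  have himg : Function.invFunOn σ A '' (σ '' A) = A := hinj.leftInvOn_invFunOn.image_image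
  calc μH[1] A = μH[1] (Function.invFunOn σ A '' (σ '' A)) := by rw [himg]
    _ ≤ _ := hL.hausdorffMeasure_image_le (d := 1) zero_le_one
    _ = μH[1] (σ '' A) := by simp
    _ ≤ μH[1] (Icc a b) := by
        apply measure_mono
        rintro _ ⟨x, hx, rfl⟩
        exact h2 x hx
    _ = ENNReal.ofReal (b - a) := by
        rw [hausdorffMeasure_real, Real.volume_Icc]

lemma proj_contract (x x' y y' : E) (h1 : inner ℝ (y - x) (x' - x) ≤ 0)
    (h2 : inner ℝ (y' - x') (x - x') ≤ 0) : dist x x' ≤ dist y y' := by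
  have key : ‖x - x'‖ ^ 2 ≤ inner ℝ (y - y') (x - x') := by
    have e : inner ℝ (y - y') (x - x') - inner ℝ (x - x') (x - x')
        = - inner ℝ (y - x) (x' - x) - inner ℝ (y' - x') (x - x') := by
      simp only [inner_sub_left, inner_sub_right]; ring
    rw [real_inner_self_eq_norm_sq] at e
    linarith
  have h3 := real_inner_le_norm (y - y') (x - x')
  rw [dist_eq_norm, dist_eq_norm]
  by_contra hlt
  push Not at hlt
  have : 0 < ‖x - x'‖ := lt_of_le_of_lt (norm_nonneg _) hlt
  nlinarith

lemma face_measure (A : Set E) (θ δ h hp hm : ℝ) (hs : 0 < Real.sin δ)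
    (hA : ∀ x ∈ A, ∃ y : E, (∀ z ∈ A, inner ℝ (y - x) (z - x) ≤ 0) ∧ inner ℝ (U θ) y = h ∧
      inner ℝ (U (θ + δ)) y ≤ hp ∧ inner ℝ (U (θ - δ)) y ≤ hm) :
    μH[1] A ≤ ENNReal.ofReal ((hp + hm - 2 * Real.cos δ * h) / Real.sin δ) := by
  choose! Y hY1 hY2 hY3 hY4 using hA
  have := measure_le_of_expand A (fun x => - Real.sin θ * Y x 0 + Real.cos θ * Y x 1)
    (-((hm - h * Real.cos δ) / Real.sin δ)) ((hp - h * Real.cos δ) / Real.sin δ) ?_ ?_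
  · convert this using 2
    ring
  · intro x hx x' hx'
    refine (proj_contract x x' (Y x) (Y x') (hY1 x hx x' hx') (hY1 x' hx' x hx)).trans ?_
    have e1 := hY2 x hx
    have e2 := hY2 x' hx'
    rw [inner_U] at e1 e2
    rw [EuclideanSpace.dist_eq, Fin.sum_univ_two, Real.dist_eq, Real.dist_eq, sq_abs, sq_abs]
    apply Real.sqrt_le_iff.2 ⟨abs_nonneg _, ?_⟩
    rw [sq_abs]
    have hcs := Real.sin_sq_add_cos_sq θ
    have e3 : Real.cos θ * (Y x 0 - Y x' 0) + Real.sin θ * (Y x 1 - Y x' 1) = 0 := by linarith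
    set p := Y x 0 - Y x' 0
    set q := Y x 1 - Y x' 1
    have e4 : -Real.sin θ * Y x 0 + Real.cos θ * Y x 1 -
      (-Real.sin θ * Y x' 0 + Real.cos θ * Y x' 1) = -Real.sin θ * p + Real.cos θ * q := by
      simp only [p, q]; ring
    rw [e4]
    apply le_of_eq
    calc p ^ 2 + q ^ 2 = (p ^ 2 + q ^ 2) * (Real.sin θ ^ 2 + Real.cos θ ^ 2) := by rw [hcs, mul_one]
      _ = (-Real.sin θ * p + Real.cos θ * q) ^ 2
          + (Real.cos θ * p + Real.sin θ * q) ^ 2 := by ring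
      _ = _ := by rw [e3]; ring
  · intro x hx
    have e1 := hY2 x hx
    have e2 := hY3 x hx
    have e3 := hY4 x hx
    rw [inner_U] at e1 e2 e3
    rw [Real.cos_add, Real.sin_add] at e2
    rw [Real.cos_sub, Real.sin_sub] at e3
    subst e1
    constructor
    · rw [neg_le, div_eq_mul_inv, ← div_eq_mul_inv, le_div_iff₀ hs]
      linarith
    · rw [le_div_iff₀ hs]
      linarith

lemma sum_shift (F : ℝ → ℝ) (n : ℕ) (δ : ℝ) (hF : F (n * δ) = F 0) :
    ∑ k ∈ Finset.range n, F (k * δ + δ) = ∑ k ∈ Finset.range n, F (k * δ) := by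
  have h1 := Finset.sum_range_succ (fun k : ℕ => F (k * δ)) n
  have h2 := Finset.sum_range_succ' (fun k : ℕ => F (k * δ)) n
  simp only [Nat.cast_zero, zero_mul, Nat.cast_add, Nat.cast_one, add_mul, one_mul] at h1 h2
  linarith

lemma sum_shift' (F : ℝ → ℝ) (n : ℕ) (δ : ℝ) (hF : F (n * δ - δ) = F (- δ)) :
    ∑ k ∈ Finset.range n, F (k * δ - δ) = ∑ k ∈ Finset.range n, F (k * δ) := by
  have := sum_shift (fun x => F (x - δ)) n δ (by simpa using hF)
  simpa using this.symm

lemma exists_pos (n : ℕ) (hn : 0 < n) (α δ : ℝ) (hd : n * δ = 2 * Real.pi) (hs : 0 < Real.sin δ)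
    (v : E) (hv : v ≠ 0) : ∃ k ∈ Finset.range n, 0 < inner ℝ (U (α + k * δ)) v := by
  by_contra hcon
  push Not at hcon
  set F : ℝ → ℝ := fun x => inner ℝ (U (α + x)) v with hF
  have hFe : ∀ x, F x = Real.cos (α + x) * v 0 + Real.sin (α + x) * v 1 := fun x => inner_U _ _
  have hper : ∀ x, F (x + 2 * Real.pi) = F x := by
    intro x
    rw [hFe, hFe, ← add_assoc, Real.cos_add_two_pi, Real.sin_add_two_pi]
  have hrec : ∀ x, F (x + δ) + F (x - δ) = 2 * Real.cos δ * F x := by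
    intro x
    rw [hFe, hFe, hFe, ← add_assoc α x δ, ← add_sub_assoc, Real.cos_add (α + x) δ, Real.sin_add (α + x) δ,
      Real.cos_sub, Real.sin_sub]
    ring
  have s1 := sum_shift F n δ (by rw [hd, ← hper 0, zero_add])
  have s2 := sum_shift' F n δ (by rw [hd, ← hper (-δ)]; congr 1; ring)
  have s3 : ∑ k ∈ Finset.range n, F (k * δ) = 0 := by
    have : ∑ k ∈ Finset.range n, F (k * δ + δ) + ∑ k ∈ Finset.range n, F (k * δ - δ)
        = 2 * Real.cos δ * ∑ k ∈ Finset.range n, F (k * δ) := by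
      rw [← Finset.sum_add_distrib, Finset.mul_sum]
      exact Finset.sum_congr rfl fun k _ => hrec _
    rw [s1, s2] at this
    have hc : Real.cos δ < 1 := by
      nlinarith [Real.sin_sq_add_cos_sq δ]
    have : (1 - Real.cos δ) * ∑ k ∈ Finset.range n, F (k * δ) = 0 := by linarith
    rcases mul_eq_zero.1 this with h | h
    · linarith
    · exact h
  have s4 := (Finset.sum_eq_zero_iff_of_nonpos (s := Finset.range n)
    (f := fun k : ℕ => F (k * δ)) hcon).1 s3
  have z0 : F 0 = 0 := by simpa using s4 0 (Finset.mem_range.2 hn)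
  have hn1 : 1 < n := by
    by_contra h
    have : n = 1 := by omega
    subst this
    rw [Nat.cast_one, one_mul] at hd
    rw [hd, Real.sin_two_pi] at hs
    exact lt_irrefl _ hs
  have z1 : F δ = 0 := by simpa using s4 1 (Finset.mem_range.2 hn1)
  rw [hFe] at z0 z1
  rw [Real.cos_add, Real.sin_add] at z1
  rw [add_zero] at z0
  have z2 : Real.sin δ * (-Real.sin α * v 0 + Real.cos α * v 1) = 0 := by
    linear_combination z1 - Real.cos δ * z0
  have z3 : -Real.sin α * v 0 + Real.cos α * v 1 = 0 := by
    rcases mul_eq_zero.1 z2 with h | h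
    · exact absurd h hs.ne'
    · exact h
  have hcs := Real.sin_sq_add_cos_sq α
  apply hv
  ext i
  fin_cases i
  · show v 0 = 0
    linear_combination Real.cos α * z0 - Real.sin α * z3 - v 0 * hcs
  · show v 1 = 0
    linear_combination Real.sin α * z0 + Real.cos α * z3 - v 1 * hcs

lemma exists_normal (K : Set E) (hKconv : Convex ℝ K) (hKint : (interior K).Nonempty)
    (x : E) (hx : x ∈ frontier K) : ∃ v : E, v ≠ 0 ∧ ∀ z ∈ K, inner ℝ v (z - x) ≤ 0 := by
  obtain ⟨f, hf⟩ := geometric_hahn_banach_open_point hKconv.interior isOpen_interior hx.2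
  refine ⟨(InnerProductSpace.toDual ℝ E).symm f, ?_, ?_⟩
  · intro h0
    rw [LinearIsometryEquiv.map_eq_zero_iff] at h0
    obtain ⟨a, ha⟩ := hKint
    have := hf a ha
    simp [h0] at this
  · intro z hz
    rw [InnerProductSpace.toDual_symm_apply, map_sub, sub_nonpos]
    have h1 : z ∈ closure (interior K) := by
      rw [hKconv.closure_interior_eq_closure_of_nonempty_interior hKint]
      exact subset_closure hz
    have h2 : closure (interior K) ⊆ {z | f z ≤ f x} :=
      closure_minimal (fun a ha => (hf a ha).le) (isClosed_le f.continuous continuous_const)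
    exact h2 h1

lemma perim_le (K : Set E) (hKc : IsCompact K) (hKconv : Convex ℝ K)
    (hKint : (interior K).Nonempty) (e : E → E)
    (heK : ∀ u, e u ∈ K) (he : ∀ u, ∀ z ∈ K, inner ℝ u z ≤ inner ℝ u (e u))
    (n : ℕ) (hn : 0 < n) (α δ : ℝ) (hd : n * δ = 2 * Real.pi) (hs : 0 < Real.sin δ)
    (hc : 0 < Real.cos δ) :
    μH[1] (frontier K) ≤ ENNReal.ofReal (2 * (1 - Real.cos δ) / Real.sin δ *
      ∑ k ∈ Finset.range n, inner ℝ (U (α + k * δ)) (e (U (α + k * δ)))) := by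
  set h : ℝ → ℝ := fun x => inner ℝ (U (α + x)) (e (U (α + x))) with hh
  have hUper : ∀ x, U (x + 2 * Real.pi) = U x := by
    intro x; simp [U]
  have hper : ∀ x, h (x + 2 * Real.pi) = h x := by
    intro x
    simp only [hh, ← add_assoc, hUper]
  set A : ℕ → Set E := fun k => {x ∈ frontier K | ∃ y : E, (∀ z ∈ K, inner ℝ (y - x) (z - x) ≤ 0) ∧
    inner ℝ (U (α + k * δ)) y = h (k * δ) ∧
      inner ℝ (U (α + k * δ + δ)) y ≤ h (k * δ + δ) ∧
      inner ℝ (U (α + k * δ - δ)) y ≤ h (k * δ - δ)} with hA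
  have hfr : frontier K ⊆ K := hKc.isClosed.frontier_subset
  have hcover : frontier K ⊆ ⋃ k ∈ Finset.range n, A k := by
    intro x hx
    obtain ⟨v, hv0, hv⟩ := exists_normal K hKconv hKint x hx
    obtain ⟨k0, hk0, hk0p⟩ := exists_pos n hn α δ hd hs v hv0
    set S := (Finset.range n).filter (fun k : ℕ => 0 < inner ℝ (U (α + k * δ)) v) with hS
    obtain ⟨k, hkS, hkmin⟩ := S.exists_min_image
      (fun k : ℕ => (h (k * δ) - inner ℝ (U (α + k * δ)) x) / inner ℝ (U (α + k * δ)) v)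
      ⟨k0, Finset.mem_filter.2 ⟨hk0, hk0p⟩⟩
    obtain ⟨hkn, hkp⟩ := Finset.mem_filter.1 hkS
    set t := (h (k * δ) - inner ℝ (U (α + k * δ)) x) / inner ℝ (U (α + k * δ)) v with ht
    have hxle : ∀ r, inner ℝ (U (α + r)) x ≤ h r := fun r => he _ x (hfr hx)
    have ht0 : 0 ≤ t := div_nonneg (sub_nonneg.2 (hxle _)) hkp.le
    have hall : ∀ j ∈ Finset.range n, inner ℝ (U (α + j * δ)) (x + t • v) ≤ h (j * δ) := by
      intro j hj
      rw [inner_add_right, inner_smul_right]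
      by_cases hjp : 0 < inner ℝ (U (α + j * δ)) v
      · have := hkmin j (Finset.mem_filter.2 ⟨hj, hjp⟩)
        rw [le_div_iff₀ hjp] at this
        linarith
      · push Not at hjp
        have := hxle (j * δ)
        nlinarith
    have hUi : ∀ r r', r' = r + 2 * Real.pi → inner ℝ (U (α + r)) (x + t • v) ≤ h r →
        inner ℝ (U (α + r')) (x + t • v) ≤ h r' := by
      intro r r' hr hle
      rw [hr, hper, ← add_assoc, hUper]
      exact hle
    have hUi' : ∀ r r', r = r' + 2 * Real.pi → inner ℝ (U (α + r)) (x + t • v) ≤ h r →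
        inner ℝ (U (α + r')) (x + t • v) ≤ h r' := by
      intro r r' hr hle
      rwa [hr, hper, ← add_assoc, hUper] at hle
    rw [Finset.mem_range] at hkn
    simp only [mem_iUnion]
    refine ⟨k, Finset.mem_range.2 hkn, hx, x + t • v, ?_, ?_, ?_, ?_⟩
    · intro z hz
      rw [add_sub_cancel_left, real_inner_smul_left]
      exact mul_nonpos_of_nonneg_of_nonpos ht0 (hv z hz)
    · rw [inner_add_right, inner_smul_right, ht, div_mul_cancel₀ _ hkp.ne']
      ring
    · rw [add_assoc]
      by_cases hk : k + 1 < n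
      · have := hall (k + 1) (Finset.mem_range.2 hk)
        rwa [Nat.cast_add, Nat.cast_one, add_mul, one_mul] at this
      · have hkn' : k + 1 = n := by omega
        refine hUi ((0 : ℕ) * δ) _ ?_ (hall 0 (Finset.mem_range.2 hn))
        rw [← hd, ← hkn']; push_cast; ring
    · rw [add_sub_assoc]
      rcases Nat.eq_zero_or_pos k with hk | hk
      · refine hUi' ((n - 1 : ℕ) * δ) _ ?_ (hall (n - 1) (Finset.mem_range.2 (by omega)))
        rw [← hd, hk, Nat.cast_sub (by omega)]; push_cast; ring
      · have := hall (k - 1) (Finset.mem_range.2 (by omega))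
        rw [Nat.cast_sub (by omega), Nat.cast_one, sub_mul, one_mul] at this
        exact this
  have hsub : ∀ x, 0 ≤ h (x + δ) + h (x - δ) - 2 * Real.cos δ * h x := by
    intro x
    have h1 := he (U (α + (x + δ))) (e (U (α + x))) (heK _)
    have h2 := he (U (α + (x - δ))) (e (U (α + x))) (heK _)
    have h3 : inner ℝ (U (α + (x + δ))) (e (U (α + x))) + inner ℝ (U (α + (x - δ))) (e (U (α + x)))
      = 2 * Real.cos δ * h x := by
      simp only [hh, inner_U]
      rw [← add_assoc α x δ, ← add_sub_assoc, Real.cos_add (α + x) δ, Real.sin_add (α + x) δ, Real.cos_sub,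
        Real.sin_sub]
      ring
    simp only [hh] at *
    linarith
  calc μH[1] (frontier K) ≤ μH[1] (⋃ k ∈ Finset.range n, A k) := measure_mono hcover
    _ ≤ ∑ k ∈ Finset.range n, μH[1] (A k) := measure_biUnion_finset_le _ _
    _ ≤ ∑ k ∈ Finset.range n, ENNReal.ofReal ((h (k * δ + δ) + h (k * δ - δ)
          - 2 * Real.cos δ * h (k * δ)) / Real.sin δ) := by
        apply Finset.sum_le_sum
        intro k _
        apply face_measure (A k) (α + k * δ) δ _ _ _ hs
        rintro x ⟨hx, y, hy1, hy2⟩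
        exact ⟨y, fun z hz => hy1 z (hfr hz.1), hy2⟩
    _ = ENNReal.ofReal (∑ k ∈ Finset.range n, ((h (k * δ + δ) + h (k * δ - δ)
          - 2 * Real.cos δ * h (k * δ)) / Real.sin δ)) := by
        rw [ENNReal.ofReal_sum_of_nonneg]
        intro k _
        exact div_nonneg (hsub _) hs.le
    _ = _ := by
        congr 1
        rw [← Finset.sum_div, Finset.sum_sub_distrib, Finset.sum_add_distrib, ← Finset.mul_sum,
          sum_shift h n δ (by rw [hd, ← hper 0, zero_add]),
          sum_shift' h n δ (by rw [hd, ← hper (-δ)]; congr 1; ring)]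
        ring

lemma integral_abs_cos : ∫ x in (0 : ℝ)..(2 * Real.pi), |Real.cos x| = 4 := by
  have hpi := Real.pi_pos
  have hi : ∀ a b, IntervalIntegrable (fun x => |Real.cos x|) volume a b :=
    fun a b => (Real.continuous_cos.abs).intervalIntegrable a b
  have hper : Function.Periodic (fun x => |Real.cos x|) (2 * Real.pi) := by
    intro x; simp
  have h0 := hper.intervalIntegral_add_eq 0 (-(Real.pi / 2))
  rw [zero_add] at h0
  rw [h0, ← intervalIntegral.integral_add_adjacent_intervals (hi _ (Real.pi / 2)) (hi _ _)]
  have e1 : ∫ x in (-(Real.pi / 2))..(Real.pi / 2), |Real.cos x| = 2 := by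
    rw [intervalIntegral.integral_congr (g := Real.cos)]
    · rw [integral_cos]; simp; norm_num
    · intro x hx
      rw [uIcc_of_le (by linarith)] at hx
      exact abs_of_nonneg (Real.cos_nonneg_of_mem_Icc hx)
  have e2 : ∫ x in (Real.pi / 2)..(-(Real.pi / 2) + 2 * Real.pi), |Real.cos x| = 2 := by
    rw [intervalIntegral.integral_congr (g := fun x => - Real.cos x)]
    · rw [intervalIntegral.integral_neg, integral_cos]; simp; norm_num
    · intro x hx
      rw [uIcc_of_le (by linarith)] at hx
      exact abs_of_nonpos (Real.cos_nonpos_of_pi_div_two_le_of_le hx.1 (by linarith [hx.2]))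
  rw [e1, e2]; norm_num

lemma sum_abs_cos (n : ℕ) (δ φ : ℝ) (hd : n * δ = 2 * Real.pi) (hδ : 0 < δ) :
    2 * Real.sin (δ / 2) * ∑ k ∈ Finset.range n, |Real.cos (φ + k * δ)| ≤ 4 := by
  have hi : ∀ a b, IntervalIntegrable (fun x => |Real.cos x|) volume a b :=
    fun a b => (Real.continuous_cos.abs).intervalIntegrable a b
  have hper : Function.Periodic (fun x => |Real.cos x|) (2 * Real.pi) := by
    intro x; simp
  have hsum := intervalIntegral.sum_integral_adjacent_intervals (μ := volume)
    (f := fun x => |Real.cos x|) (a := fun k : ℕ => φ - δ / 2 + k * δ) (n := n) (fun k _ => hi _ _)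
  rw [hd, Nat.cast_zero, zero_mul, add_zero,
    hper.intervalIntegral_add_eq (φ - δ / 2) 0, zero_add, integral_abs_cos] at hsum
  rw [← hsum, Finset.mul_sum]
  apply Finset.sum_le_sum
  intro k _
  have h1 := intervalIntegral.abs_integral_le_integral_abs (μ := volume) (f := Real.cos)
    (a := φ - δ / 2 + k * δ) (b := φ - δ / 2 + (k + 1 : ℕ) * δ)
    (by push_cast; nlinarith)
  refine le_trans ?_ h1
  rw [integral_cos]
  have e1 : φ - δ / 2 + (k + 1 : ℕ) * δ = (φ + k * δ) + δ / 2 := by push_cast; ring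
  have e2 : φ - δ / 2 + k * δ = (φ + k * δ) - δ / 2 := by ring
  rw [e1, e2, Real.sin_add, Real.sin_sub]
  have e3 : Real.sin (φ + k * δ) * Real.cos (δ / 2) + Real.cos (φ + k * δ) * Real.sin (δ / 2)
    - (Real.sin (φ + k * δ) * Real.cos (δ / 2) - Real.cos (φ + k * δ) * Real.sin (δ / 2))
    = 2 * Real.sin (δ / 2) * Real.cos (φ + k * δ) := by ring
  rw [e3, abs_mul]
  exact mul_le_mul_of_nonneg_right (le_abs_self _) (abs_nonneg _)

lemma sum_abs_inner (n : ℕ) (δ : ℝ) (hd : n * δ = 2 * Real.pi) (hδ : 0 < δ) (w : E) :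
    2 * Real.sin (δ / 2) * ∑ k ∈ Finset.range n, |inner ℝ (U (k * δ)) w| ≤ 4 * ‖w‖ := by
  set c : ℂ := ⟨w 0, w 1⟩ with hc
  have hn : ‖c‖ = ‖w‖ := by
    rw [EuclideanSpace.norm_eq, Fin.sum_univ_two, Complex.norm_eq_sqrt_sq_add_sq]
    simp [hc]
  have h0 : w 0 = ‖w‖ * Real.cos c.arg := by
    rw [← hn, Complex.norm_mul_cos_arg]
  have h1 : w 1 = ‖w‖ * Real.sin c.arg := by
    rw [← hn, Complex.norm_mul_sin_arg]
  have e : ∀ k : ℕ, |inner ℝ (U (k * δ)) w| = ‖w‖ * |Real.cos (-c.arg + k * δ)| := by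
    intro k
    rw [inner_U, h0, h1]
    rw [← abs_of_nonneg (norm_nonneg w), ← abs_mul, abs_of_nonneg (norm_nonneg w), Real.cos_add,
      Real.cos_neg, Real.sin_neg]
    congr 1
    ring
  simp only [e]
  rw [← Finset.mul_sum]
  have := mul_le_mul_of_nonneg_left (sum_abs_cos n δ (-c.arg) hd hδ) (norm_nonneg w)
  linarith

lemma oneD (x : ℕ → ℝ) (N a b : ℕ) (ha : a ≤ N) (hb : b ≤ N) :
    2 * (x a - x b) ≤ ∑ i ∈ Finset.range N, |x (i + 1) - x i| + |x N - x 0| := by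
  have key : ∀ a b, a ≤ b → b ≤ N →
      2 * |x a - x b| ≤ ∑ i ∈ Finset.range N, |x (i + 1) - x i| + |x N - x 0| := by
    intro a b hab hb
    have s1 := dist_le_Ico_sum_dist x (Nat.zero_le a)
    have s2 := dist_le_Ico_sum_dist x hab
    have s3 := dist_le_Ico_sum_dist x hb
    have e1 := Finset.sum_Ico_consecutive (fun i => dist (x i) (x (i + 1))) (Nat.zero_le a) hab
    have e2 := Finset.sum_Ico_consecutive (fun i => dist (x i) (x (i + 1)))
      (Nat.zero_le b) hb
    have e3 : ∑ i ∈ Finset.range N, |x (i + 1) - x i|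
        = ∑ i ∈ Finset.Ico 0 N, dist (x i) (x (i + 1)) := by
      rw [Finset.range_eq_Ico]
      exact Finset.sum_congr rfl fun i _ => by rw [Real.dist_eq, abs_sub_comm]
    have t1 := dist_triangle4 (x a) (x 0) (x N) (x b)
    rw [dist_comm (x a) (x 0), dist_comm (x N) (x b), dist_comm (x 0) (x N)] at t1
    rw [e3, ← Real.dist_eq, ← Real.dist_eq]
    linarith
  rcases le_total a b with h | h
  · linarith [key a b h hb, le_abs_self (x a - x b)]
  · have := key b a h ha
    rw [abs_sub_comm] at this
    linarith [le_abs_self (x a - x b)]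

lemma exists_ext (K : Set E) (hKc : IsCompact K) (hne : K.Nonempty) (u : E) :
    ∃ e ∈ Set.extremePoints ℝ K, ∀ z ∈ K, inner ℝ u z ≤ inner ℝ u e := by
  have hexp : IsExposed ℝ K ((innerSL ℝ u).toExposed K) :=
    ContinuousLinearMap.toExposed.isExposed
  have hcomp : IsCompact ((innerSL ℝ u).toExposed K) := hexp.isCompact hKc
  obtain ⟨m, hmK, hm⟩ := hKc.exists_isMaxOn hne (innerSL ℝ u).continuous.continuousOn
  have hne' : ((innerSL ℝ u).toExposed K).Nonempty := ⟨m, hmK, fun y hy => hm hy⟩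
  obtain ⟨e, he⟩ := hcomp.extremePoints_nonempty hne'
  exact ⟨e, hexp.isExtreme.extremePoints_subset_extremePoints he, fun z hz => he.1.2 z hz⟩

lemma finset_enum (T : Finset ℝ) (hT : T.Nonempty) :
    ∃ (N : ℕ) (t : ℕ → ℝ), Monotone t ∧ (∀ i, t i ∈ T) ∧ ∀ s ∈ T, ∃ i ≤ N, t i = s := by
  obtain ⟨N, hN⟩ : ∃ N, T.card = N + 1 := ⟨T.card - 1, by have := hT.card_pos; omega⟩
  refine ⟨N, fun i => T.orderEmbOfFin hN ⟨min i N, by omega⟩, ?_, ?_, ?_⟩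
  · intro i j hij
    apply (T.orderEmbOfFin hN).monotone
    simp only [Fin.mk_le_mk]
    omega
  · intro i
    exact T.orderEmbOfFin_mem hN _
  · intro s hs
    have : s ∈ Set.range (T.orderEmbOfFin hN) := by rw [Finset.range_orderEmbOfFin]; exact hs
    obtain ⟨⟨i, hi⟩, rfl⟩ := this
    refine ⟨i, by omega, ?_⟩
    have hm : min i N = i := by omega
    simp only [hm]

lemma main_bound (K : Set E)
    (hKc : IsCompact K) (hKconv : Convex ℝ K) (hKint : (interior K).Nonempty)
    (γ : ℝ → E) (hext : ∀ x ∈ Set.extremePoints ℝ K, x ∈ γ '' Icc 0 1)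
    (n : ℕ) (hn : 4 < n) :
    μH[1] (frontier K) ≤ ENNReal.ofReal (1 / Real.cos (Real.pi / n)) *
      (eVariationOn γ (Icc 0 1) + ENNReal.ofReal (diam K)) := by
  have hpi := Real.pi_pos
  have hn' : (4 : ℝ) < n := by exact_mod_cast hn
  have hn0 : (0 : ℝ) < n := by linarith
  set δ : ℝ := 2 * Real.pi / n with hδ
  have hδ2 : Real.pi / n = δ / 2 := by rw [hδ]; ring
  have hd : n * δ = 2 * Real.pi := by rw [hδ]; field_simp
  have hδ0 : 0 < δ := by positivity
  have hδ1 : δ < Real.pi / 2 := by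
    rw [hδ, div_lt_iff₀ hn0]; nlinarith
  have hs : 0 < Real.sin δ := Real.sin_pos_of_pos_of_lt_pi hδ0 (by linarith)
  have hc : 0 < Real.cos δ := Real.cos_pos_of_mem_Ioo ⟨by linarith, hδ1⟩
  have hs2 : 0 < Real.sin (δ / 2) := Real.sin_pos_of_pos_of_lt_pi (by linarith) (by linarith)
  have hc2 : 0 < Real.cos (δ / 2) := Real.cos_pos_of_mem_Ioo ⟨by linarith, by linarith⟩
  rw [hδ2]
  have hex : ∀ u : E, ∃ s : ℝ, s ∈ Icc (0 : ℝ) 1 ∧ γ s ∈ K ∧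
      ∀ z ∈ K, inner ℝ u z ≤ inner ℝ u (γ s) := by
    intro u
    obtain ⟨x, hx, hxm⟩ := exists_ext K hKc (hKint.mono interior_subset) u
    obtain ⟨s, hs, rfl⟩ := hext x hx
    exact ⟨s, hs, hx.1, hxm⟩
  choose s hs01 hsK hsm using hex
  set T : Finset ℝ := (Finset.range n).image (fun k : ℕ => s (U (0 + k * δ))) ∪
    (Finset.range n).image (fun k : ℕ => s (U (Real.pi + k * δ))) with hT
  have hTne : T.Nonempty := by
    refine ⟨s (U (0 + (0 : ℕ) * δ)), Finset.mem_union_left _ (Finset.mem_image.2 ⟨0, ?_, rfl⟩)⟩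
    exact Finset.mem_range.2 (by omega)
  have hTp : ∀ r ∈ T, r ∈ Icc (0 : ℝ) 1 ∧ γ r ∈ K := by
    intro r hr
    rcases Finset.mem_union.1 hr with h | h
    all_goals
      obtain ⟨k, _, rfl⟩ := Finset.mem_image.1 h
      exact ⟨hs01 _, hsK _⟩
  obtain ⟨N, t, htm, htT, hts⟩ := finset_enum T hTne
  set p : ℕ → E := fun i => γ (t i) with hp
  set ℓ : ℝ := ∑ i ∈ Finset.range N, ‖p (i + 1) - p i‖ + ‖p N - p 0‖ with hℓ
  have hℓle : ENNReal.ofReal ℓ ≤ eVariationOn γ (Icc 0 1) + ENNReal.ofReal (diam K) := by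
    rw [hℓ, ENNReal.ofReal_add (Finset.sum_nonneg fun i _ => norm_nonneg _) (norm_nonneg _)]
    apply add_le_add
    · rw [ENNReal.ofReal_sum_of_nonneg (fun i _ => norm_nonneg _)]
      have := eVariationOn.sum_le (f := γ) (s := Icc 0 1) (n := N) htm (fun i => (hTp _ (htT i)).1)
      refine le_trans (le_of_eq ?_) this
      refine Finset.sum_congr rfl fun i _ => ?_
      rw [edist_dist, dist_eq_norm]
    · apply ENNReal.ofReal_le_ofReal
      rw [← dist_eq_norm]
      exact dist_le_diam_of_mem hKc.isBounded (hTp _ (htT N)).2 (hTp _ (htT 0)).2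
  have hB := fun α => perim_le K hKc hKconv hKint (fun u => γ (s u)) hsK hsm n (by omega) α δ hd hs hc
  have hUneg : ∀ x, U (Real.pi + x) = - U x := by
    intro x
    ext i
    fin_cases i <;> simp [U, add_comm Real.pi]
  set c : ℝ := 2 * (1 - Real.cos δ) / Real.sin δ with hcdef
  have hc0 : 0 ≤ c := div_nonneg (by linarith [Real.cos_le_one δ]) hs.le
  set S0 : ℝ := ∑ k ∈ Finset.range n, inner ℝ (U (0 + k * δ)) (γ (s (U (0 + k * δ))))
  set S1 : ℝ := ∑ k ∈ Finset.range n, inner ℝ (U (Real.pi + k * δ)) (γ (s (U (Real.pi + k * δ))))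
  have hk : ∀ k ∈ Finset.range n, 2 * (inner ℝ (U (0 + k * δ)) (γ (s (U (0 + k * δ)))) +
      inner ℝ (U (Real.pi + k * δ)) (γ (s (U (Real.pi + k * δ))))) ≤
      ∑ i ∈ Finset.range N, |inner ℝ (U (k * δ)) (p (i + 1) - p i)| +
        |inner ℝ (U (k * δ)) (p N - p 0)| := by
    intro k hk
    obtain ⟨a, ha, hta⟩ := hts (s (U (0 + k * δ)))
      (Finset.mem_union_left _ (Finset.mem_image.2 ⟨k, hk, rfl⟩))
    obtain ⟨b, hb, htb⟩ := hts (s (U (Real.pi + k * δ)))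
      (Finset.mem_union_right _ (Finset.mem_image.2 ⟨k, hk, rfl⟩))
    have := oneD (fun i => inner ℝ (U (k * δ)) (p i)) N a b ha hb
    simp only [inner_sub_right]
    refine le_trans (le_of_eq ?_) this
    simp only [hp, hta, htb]
    rw [hUneg, zero_add, inner_neg_left]
    ring
  have hsum : 2 * (S0 + S1) ≤ ∑ i ∈ Finset.range N, ∑ k ∈ Finset.range n,
      |inner ℝ (U (k * δ)) (p (i + 1) - p i)| +
      ∑ k ∈ Finset.range n, |inner ℝ (U (k * δ)) (p N - p 0)| := by
    have := Finset.sum_le_sum hk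
    rw [← Finset.mul_sum, Finset.sum_add_distrib, Finset.sum_add_distrib, Finset.sum_comm] at this
    exact this
  have hfin : 2 * Real.sin (δ / 2) * (2 * (S0 + S1)) ≤ 4 * ℓ := by
    refine (mul_le_mul_of_nonneg_left hsum (by positivity)).trans ?_
    rw [hℓ, mul_add, mul_add]
    refine add_le_add ?_ (sum_abs_inner n δ hd hδ0 _)
    rw [Finset.mul_sum, Finset.mul_sum]
    exact Finset.sum_le_sum fun i _ => sum_abs_inner n δ hd hδ0 _
  have hcval : c = 2 * (Real.sin (δ / 2) / Real.cos (δ / 2)) := by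
    have e1 : Real.sin δ = 2 * Real.sin (δ / 2) * Real.cos (δ / 2) := by
      rw [← Real.sin_two_mul]; congr 1; ring
    have e2 : Real.cos δ = 1 - 2 * Real.sin (δ / 2) ^ 2 := by
      have : Real.cos δ = Real.cos (2 * (δ / 2)) := by congr 1; ring
      rw [this, Real.cos_two_mul]
      linarith [Real.sin_sq_add_cos_sq (δ / 2)]
    rw [hcdef, e1, e2]
    field_simp
    ring
  have hmin : c * min S0 S1 ≤ 1 / Real.cos (δ / 2) * ℓ := by
    have h1 : 2 * min S0 S1 ≤ S0 + S1 := by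
      linarith [min_le_left S0 S1, min_le_right S0 S1]
    rw [hcval, mul_assoc, div_mul_eq_mul_div, one_div, inv_mul_eq_div, ← mul_div_assoc]
    apply div_le_div_of_nonneg_right _ hc2.le
    nlinarith
  have hmu : μH[1] (frontier K) ≤ ENNReal.ofReal (c * min S0 S1) := by
    rcases min_choice S0 S1 with h | h <;> rw [h]
    · exact hB 0
    · exact hB Real.pi
  calc μH[1] (frontier K) ≤ ENNReal.ofReal (1 / Real.cos (δ / 2) * ℓ) :=
        hmu.trans (ENNReal.ofReal_le_ofReal hmin)
    _ = ENNReal.ofReal (1 / Real.cos (δ / 2)) * ENNReal.ofReal ℓ :=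
        ENNReal.ofReal_mul (by positivity)
    _ ≤ _ := by gcongr

end PerDiam

/-- If a rectifiable curve `γ` passes through all extreme points of a planar compact
convex body `K`, then the length of `γ` is at least `per K − diam K`. -/
theorem stmt6 (K : Set (EuclideanSpace ℝ (Fin 2)))
    (hKc : IsCompact K) (hKconv : Convex ℝ K) (hKint : (interior K).Nonempty)
    (γ : ℝ → EuclideanSpace ℝ (Fin 2)) (hγc : ContinuousOn γ (Icc 0 1))
    (hγrect : eVariationOn γ (Icc 0 1) ≠ ⊤)
    (hext : ∀ x ∈ Set.extremePoints ℝ K, x ∈ γ '' Icc 0 1) :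
    μH[1] (frontier K) - ENNReal.ofReal (diam K) ≤ eVariationOn γ (Icc 0 1) := by
  rw [tsub_le_iff_right]
  set X := eVariationOn γ (Icc 0 1) + ENNReal.ofReal (diam K) with hX
  have hXt : X ≠ ⊤ := ENNReal.add_ne_top.2 ⟨hγrect, ENNReal.ofReal_ne_top⟩
  have hlim0 : Filter.Tendsto (fun n : ℕ => 1 / Real.cos (Real.pi / n)) Filter.atTop
      (nhds 1) := by
    have h1 : Filter.Tendsto (fun n : ℕ => Real.pi / n) Filter.atTop (nhds 0) :=
      tendsto_const_div_atTop_nhds_zero_nat _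
    have h2 := (Real.continuous_cos.tendsto 0).comp h1
    rw [Real.cos_zero] at h2
    have h3 := h2.inv₀ one_ne_zero
    simpa [Function.comp_def] using h3
  have hlim : Filter.Tendsto (fun n : ℕ => ENNReal.ofReal (1 / Real.cos (Real.pi / n)) * X)
      Filter.atTop (nhds (ENNReal.ofReal 1 * X)) :=
    ENNReal.Tendsto.mul_const (ENNReal.tendsto_ofReal hlim0) (Or.inr hXt)
  rw [ENNReal.ofReal_one, one_mul] at hlim
  refine ge_of_tendsto hlim ?_
  filter_upwards [Filter.eventually_gt_atTop 4] with n hn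
  exact PerDiam.main_bound K hKc hKconv hKint γ hext n hn
end
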